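/- (Non-Hermitian polynomial moments.) Let F : ℝⁿ → ℝ^{d_1 × d_2} be a (sufficiently smooth, e.g. polynomial) matrix-valued function and let x ∼ N(0, I_n) be a standard Gaussian vector in ℝⁿ. Then for t = 1 and for t ≥ 1.5, E ‖F(x) − E F(x)‖_{2t}^{2t} ≤ (√2 t)^{2t} · ( E ‖(Σ_{i=1}^n ∂_i F(x) · ∂_i F(x)ᵀ)^{1/2}‖_{2t}^{2t} + E ‖(Σ_{i=1}^n ∂_i F(x)ᵀ · ∂_i F(x))^{1/2}‖_{2t}^{2t} ). -/

import Mathlib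

open MeasureTheory ProbabilityTheory Matrix
open scoped BigOperators ENNReal

/-- Entrywise expectation of a random matrix. -/
noncomputable def matIntegral {Ω : Type*} [MeasurableSpace Ω] (μ : Measure Ω)
    {R C : Type*} (M : Ω → Matrix R C ℝ) : Matrix R C ℝ :=
  Matrix.of fun i j => ∫ ω, M ω i j ∂μ

/-- `schattenPow t A = tr ((AᴴA)^t) = ‖A‖_{2t}^{2t}`, the `2t`-th power of the Schatten
`2t`-norm of a real matrix `A`, defined for a real exponent `t` via the eigenvalues of
the Hermitian matrix `AᴴA`. -/
noncomputable def schattenPow {R C : Type*} [Fintype R] [Fintype C] [DecidableEq C]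
    (t : ℝ) (A : Matrix R C ℝ) : ℝ :=
  ∑ i, (Matrix.isHermitian_conjTranspose_mul_self A).eigenvalues i ^ t

/-- The Schatten `2t`-norm of a real matrix: `‖A‖_{2t} = (tr ((AᴴA)^t))^(1/(2t))`. -/
noncomputable def schattenNorm {R C : Type*} [Fintype R] [Fintype C] [DecidableEq C]
    (t : ℝ) (A : Matrix R C ℝ) : ℝ :=
  schattenPow t A ^ (2 * t)⁻¹
/-- Entrywise partial derivative of a matrix-valued function with respect to the
coordinate `v`. -/
noncomputable def pderivAt {ι : Type*} [Fintype ι] [DecidableEq ι] {R C : Type*}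
    (F : (ι → ℝ) → Matrix R C ℝ) (v : ι) : (ι → ℝ) → Matrix R C ℝ :=
  fun x => Matrix.of fun r c => fderiv ℝ (fun y => F y r c) x (Pi.single v 1)

/-- Iterated entrywise partial derivative along a tuple of coordinates. -/
noncomputable def iterPDeriv {ι : Type*} [Fintype ι] [DecidableEq ι] {R C : Type*}
    (F : (ι → ℝ) → Matrix R C ℝ) : {k : ℕ} → (Fin k → ι) → (ι → ℝ) → Matrix R C ℝ
  | 0, _ => F
  | _ + 1, w => pderivAt (iterPDeriv F fun j => w j.castSucc) (w (Fin.last _))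

/-- The partial-derivative block matrix `F_{a,b,c}`: rows carry the `a` vertically stacked
derivative directions, columns the `b` horizontally placed ones, and the `c` block-diagonal
directions appear in both (with the diagonal constraint). -/
noncomputable def derivBlocks {n : ℕ} {R C : Type*}
    (F : (Fin n → ℝ) → Matrix R C ℝ) (a b c : ℕ) :
    (Fin n → ℝ) →
      Matrix ((Fin a → Fin n) × (Fin c → Fin n) × R) ((Fin b → Fin n) × (Fin c → Fin n) × C) ℝ :=
  fun x => Matrix.of fun p q =>
    if p.2.1 = q.2.1 then
      iterPDeriv F (Fin.append (Fin.append p.1 q.1) p.2.1) x p.2.2 q.2.2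
    else 0

/-- The partial-derivative block matrix `F_{a,b}` (no diagonal blocks): rows carry the `a`
vertically stacked derivative directions and columns the `b` horizontally placed ones. -/
noncomputable def derivBlocks2 {ι : Type*} [Fintype ι] [DecidableEq ι] {R C : Type*}
    (F : (ι → ℝ) → Matrix R C ℝ) (a b : ℕ) :
    (ι → ℝ) → Matrix ((Fin a → ι) × R) ((Fin b → ι) × C) ℝ :=
  fun x => Matrix.of fun p q => iterPDeriv F (Fin.append p.1 q.1) x p.2 q.2

/-- Mathlib's former `Matrix.PosSemidef.sqrt` (since removed), for real matrices. -/
noncomputable def Matrix.PosSemidef.sqrt {m : Type*} [Fintype m] [DecidableEq m]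
    {A : Matrix m m ℝ} (hA : A.PosSemidef) : Matrix m m ℝ :=
  hA.1.eigenvectorUnitary.1 * diagonal (Real.sqrt ∘ hA.1.eigenvalues) *
    (star hA.1.eigenvectorUnitary : Matrix m m ℝ)

/-- The positive semidefinite square root of a positive semidefinite matrix
(junk value `0` if the matrix is not positive semidefinite). -/
noncomputable def psdSqrt {m : Type*} [Fintype m] [DecidableEq m] (P : Matrix m m ℝ) :
    Matrix m m ℝ :=
  @dite _ P.PosSemidef (Classical.dec _) (fun h => h.sqrt) (fun _ => 0)


section SpectralTools

variable {m : Type*} [Fintype m] [DecidableEq m]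

/-- Trace functional calculus. -/
noncomputable def trf (f : ℝ → ℝ) (A : Matrix m m ℝ) : ℝ := (cfc f A).trace

lemma exists_spec {A : Matrix m m ℝ} (hA : A.IsHermitian) :
    ∃ U : Matrix m m ℝ, Uᵀ * U = 1 ∧ U * Uᵀ = 1 ∧
      ∀ f : ℝ → ℝ, cfc f A = U * diagonal (f ∘ hA.eigenvalues) * Uᵀ := by
  refine ⟨hA.eigenvectorUnitary, ?_, ?_, ?_⟩
  · have := Unitary.coe_star_mul_self hA.eigenvectorUnitary
    simpa [star_eq_conjTranspose] using this
  · have := Unitary.coe_mul_star_self hA.eigenvectorUnitary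
    simpa [star_eq_conjTranspose] using this
  · intro f
    rw [hA.cfc_eq, IsHermitian.cfc, Unitary.conjStarAlgAut_apply]
    simp [star_eq_conjTranspose, Function.comp_def]

lemma trf_eq {A : Matrix m m ℝ} (hA : A.IsHermitian) (f : ℝ → ℝ) :
    trf f A = ∑ i, f (hA.eigenvalues i) := by
  obtain ⟨U, h1, h2, h3⟩ := exists_spec hA
  rw [trf, h3, Matrix.mul_assoc, Matrix.trace_mul_comm, Matrix.mul_assoc, h1]
  simp [Matrix.trace]

lemma cfc_id_mat {A : Matrix m m ℝ} (hA : A.IsHermitian) : cfc (fun x : ℝ => x) A = A :=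
  cfc_id' ℝ A hA

lemma cfc_one_mat {A : Matrix m m ℝ} (hA : A.IsHermitian) : cfc (fun _ : ℝ => (1 : ℝ)) A = 1 :=
  cfc_const_one ℝ A hA

lemma cfc_mul_mat {A : Matrix m m ℝ} (f g : ℝ → ℝ) :
    cfc (fun x => f x * g x) A = cfc f A * cfc g A := by
  have hc : ∀ f : ℝ → ℝ, ContinuousOn f (spectrum ℝ A) := fun f =>
    (Matrix.finite_real_spectrum (A := A)).continuousOn f
  exact cfc_mul f g A (hc f) (hc g)

lemma cfc_add_mat {A : Matrix m m ℝ} (f g : ℝ → ℝ) :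
    cfc (fun x => f x + g x) A = cfc f A + cfc g A := by
  have hc : ∀ f : ℝ → ℝ, ContinuousOn f (spectrum ℝ A) := fun f =>
    (Matrix.finite_real_spectrum (A := A)).continuousOn f
  exact cfc_add A f g (hc f) (hc g)

lemma trace_mul_diag (W : Matrix m m ℝ) (a b : m → ℝ) :
    (diagonal a * W * diagonal b * Wᵀ).trace = ∑ i, ∑ j, W i j ^ 2 * (a i * b j) := by
  simp only [Matrix.trace, Matrix.diag, Matrix.mul_apply (N := Wᵀ), Matrix.mul_diagonal,
    Matrix.diagonal_mul, Matrix.transpose_apply]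
  refine Finset.sum_congr rfl fun i _ => Finset.sum_congr rfl fun j _ => by ring

/-- Main double sum representation. -/
lemma dsum {A B : Matrix m m ℝ} (hA : A.IsHermitian) (hB : B.IsHermitian) :
    ∃ (a b : m → ℝ) (w : m → m → ℝ), (∀ i j, 0 ≤ w i j) ∧
      ∀ f g : ℝ → ℝ, (cfc f A * cfc g B).trace = ∑ i, ∑ j, w i j * (f (a i) * g (b j)) := by
  obtain ⟨U, h1, h2, h3⟩ := exists_spec hA
  obtain ⟨V, k1, k2, k3⟩ := exists_spec hB
  refine ⟨hA.eigenvalues, hB.eigenvalues, fun i j => (Uᵀ * V) i j ^ 2, fun i j => sq_nonneg _, ?_⟩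
  intro f g
  rw [h3, k3]
  have := trace_mul_diag (Uᵀ * V) (f ∘ hA.eigenvalues) (g ∘ hB.eigenvalues)
  simp only [Function.comp_apply] at this
  rw [← this, Matrix.transpose_mul, Matrix.transpose_transpose]
  simp only [Matrix.mul_assoc]
  rw [Matrix.trace_mul_comm]
  simp only [Matrix.mul_assoc]

/-- Pointwise comparison lifts to traces. -/
lemma trace_le_of_pointwise {A B : Matrix m m ℝ} (hA : A.IsHermitian) (hB : B.IsHermitian)
    {ι : Type*} (s : Finset ι) (c : ι → ℝ) (f g : ι → ℝ → ℝ)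
    (h : ∀ a b, 0 ≤ ∑ k ∈ s, c k * (f k a * g k b)) :
    0 ≤ ∑ k ∈ s, c k * (cfc (f k) A * cfc (g k) B).trace := by
  obtain ⟨a, b, w, hw, H⟩ := dsum hA hB
  simp only [H]
  have : ∑ k ∈ s, c k * ∑ i, ∑ j, w i j * (f k (a i) * g k (b j))
      = ∑ i, ∑ j, w i j * ∑ k ∈ s, c k * (f k (a i) * g k (b j)) := by
    simp only [Finset.mul_sum]
    rw [Finset.sum_comm]
    refine Finset.sum_congr rfl fun i _ => ?_
    rw [Finset.sum_comm]
    refine Finset.sum_congr rfl fun j _ => Finset.sum_congr rfl fun k _ => by ring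
  rw [this]
  exact Finset.sum_nonneg fun i _ => Finset.sum_nonneg fun j _ => mul_nonneg (hw i j) (h _ _)

lemma trf_nonneg {f : ℝ → ℝ} (hf : ∀ x, 0 ≤ f x) {A : Matrix m m ℝ} (hA : A.IsHermitian) :
    0 ≤ trf f A := by
  rw [trf_eq hA]; exact Finset.sum_nonneg fun i _ => hf _

/-- Peierls inequality. -/
lemma peierls {f : ℝ → ℝ} (hf : ConvexOn ℝ Set.univ f) {N : Matrix m m ℝ} (hN : N.IsHermitian)
    (U : Matrix m m ℝ) (h1 : Uᵀ * U = 1) (h2 : U * Uᵀ = 1) :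
    ∑ i, f ((Uᵀ * N * U) i i) ≤ trf f N := by
  obtain ⟨V, k1, k2, k3⟩ := exists_spec hN
  set W := Uᵀ * V with hW
  have hWW : W * Wᵀ = 1 := by
    rw [hW, transpose_mul, transpose_transpose, Matrix.mul_assoc, ← Matrix.mul_assoc V, k2,
      Matrix.one_mul, h1]
  have hWW' : Wᵀ * W = 1 := by
    rw [hW, transpose_mul, transpose_transpose, Matrix.mul_assoc, ← Matrix.mul_assoc U, h2,
      Matrix.one_mul, k1]
  have hrow : ∀ i, ∑ j, W i j ^ 2 = 1 := fun i => by
    have := congrFun (congrFun hWW i) i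
    simpa [Matrix.mul_apply, sq] using this
  have hcol : ∀ j, ∑ i, W i j ^ 2 = 1 := fun j => by
    have := congrFun (congrFun hWW' j) j
    simpa [Matrix.mul_apply, sq] using this
  have hent : ∀ i, (Uᵀ * N * U) i i = ∑ j, W i j ^ 2 • hN.eigenvalues j := fun i => by
    have e : Uᵀ * N * U = W * diagonal hN.eigenvalues * Wᵀ := by
      conv_lhs => rw [← cfc_id_mat hN, k3]
      rw [hW, transpose_mul, transpose_transpose]
      simp only [Matrix.mul_assoc]
      rfl
    rw [e]
    simp only [Matrix.mul_apply (N := Wᵀ), Matrix.mul_diagonal, transpose_apply, smul_eq_mul]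
    refine Finset.sum_congr rfl fun j _ => by ring
  calc ∑ i, f ((Uᵀ * N * U) i i) ≤ ∑ i, ∑ j, W i j ^ 2 • f (hN.eigenvalues j) := by
        refine Finset.sum_le_sum fun i _ => ?_
        rw [hent]
        exact hf.map_sum_le (fun j _ => sq_nonneg _) (hrow i) (fun j _ => Set.mem_univ _)
    _ = trf f N := by
        rw [trf_eq hN, Finset.sum_comm]
        refine Finset.sum_congr rfl fun j _ => ?_
        rw [← Finset.sum_smul, hcol, one_smul]

open scoped Matrix.Norms.L2Operator in
lemma continuous_cfc_mat {X : Type*} [TopologicalSpace X] {f : ℝ → ℝ} (hf : Continuous f)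
    {a : X → Matrix m m ℝ} (ha : Continuous a) (hH : ∀ x, (a x).IsHermitian) :
    Continuous fun x => cfc f (a x) :=
  Continuous.cfc_of_mem_nhdsSet (s := Set.univ) (p := IsSelfAdjoint) f Filter.univ_mem ha
    (fun x => hH x) hf.continuousOn

lemma continuous_trf {X : Type*} [TopologicalSpace X] {f : ℝ → ℝ} (hf : Continuous f)
    {a : X → Matrix m m ℝ} (ha : Continuous a) (hH : ∀ x, (a x).IsHermitian) :
    Continuous fun x => trf f (a x) :=
  (continuous_cfc_mat hf ha hH).matrix_trace

lemma trf_comp_mul {A : Matrix m m ℝ} (hA : A.IsHermitian) (f : ℝ → ℝ) (r : ℝ) :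
    trf f (r • A) = trf (fun x => f (r * x)) A := by
  unfold trf
  rw [cfc_comp_const_mul (p := IsSelfAdjoint) r f A
    (((Matrix.finite_real_spectrum (A := A)).image _).continuousOn f) hA]

end SpectralTools

section ScalarTools

/-- `ψ(x) = |x|^(2t-2)`. -/
noncomputable def psiF (t : ℝ) (x : ℝ) : ℝ := |x| ^ (2 * t - 2)
/-- `φ(x) = x|x|^(2t-2)`. -/
noncomputable def phiF (t : ℝ) (x : ℝ) : ℝ := x * psiF t x
/-- `|x|^p`. -/
noncomputable def absP (p : ℝ) (x : ℝ) : ℝ := |x| ^ p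

lemma psiF_nonneg (t x : ℝ) : 0 ≤ psiF t x := Real.rpow_nonneg (abs_nonneg _) _
lemma absP_nonneg (p x : ℝ) : 0 ≤ absP p x := Real.rpow_nonneg (abs_nonneg _) _

lemma continuous_psiF {t : ℝ} (ht : 1 ≤ t) : Continuous (psiF t) :=
  continuous_abs.rpow_const fun _ => Or.inr (by linarith)

lemma continuous_absP {p : ℝ} (hp : 0 ≤ p) : Continuous (absP p) :=
  continuous_abs.rpow_const fun _ => Or.inr hp

lemma continuous_phiF {t : ℝ} (ht : 1 ≤ t) : Continuous (phiF t) :=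
  continuous_id.mul (continuous_psiF ht)

lemma absP_eq {t : ℝ} (ht : 1 ≤ t) (x : ℝ) : absP (2 * t) x = x * phiF t x := by
  unfold absP phiF psiF
  rcases eq_or_ne x 0 with rfl | hx
  · simp; rw [Real.zero_rpow (by linarith)]
  · have hx' : 0 < |x| := abs_pos.mpr hx
    have : (2 * t) = 2 + (2 * t - 2) := by ring
    conv_lhs => rw [this, Real.rpow_add hx']
    rw [← mul_assoc]; congr 1
    rw [Real.rpow_two, sq_abs, sq]

lemma convexOn_absP {p : ℝ} (hp : 1 ≤ p) : ConvexOn ℝ Set.univ (absP p) := by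
  have h1 : ConvexOn ℝ Set.univ (fun x : ℝ => |x|) := convexOn_univ_norm (E := ℝ)
  refine ⟨convex_univ, fun x _ y _ a b ha hb hab => ?_⟩
  have := h1.2 (Set.mem_univ x) (Set.mem_univ y) ha hb hab
  calc absP p (a • x + b • y) ≤ (a • |x| + b • |y|) ^ p :=
        Real.rpow_le_rpow (abs_nonneg _) this (by linarith)
    _ ≤ _ := (convexOn_rpow hp).2 (abs_nonneg x) (abs_nonneg y) ha hb hab

lemma hh_pos {q a b : ℝ} (hq : 1 ≤ q) (ha : 0 ≤ a) (hab : a ≤ b) :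
    b ^ (q + 1) - a ^ (q + 1) ≤ (q + 1) / 2 * ((b - a) * (a ^ q + b ^ q)) := by
  let h : ℝ → ℝ := fun x => (q + 1) / 2 * ((x - a) * (a ^ q + x ^ q)) - (x ^ (q + 1) - a ^ (q + 1))
  have hd : ∀ x, a < x → HasDerivAt h ((q + 1) / 2 * (1 * (a ^ q + x ^ q) +
      (x - a) * (q * x ^ (q - 1))) - (q + 1) * x ^ (q + 1 - 1)) x := by
    intro x hx
    have hx0 : x ≠ 0 := by linarith
    have e1 := Real.hasDerivAt_rpow_const (x := x) (p := q) (Or.inl hx0)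
    have e2 := Real.hasDerivAt_rpow_const (x := x) (p := q + 1) (Or.inl hx0)
    exact ((((hasDerivAt_id x).sub_const a).mul (e1.const_add (a ^ q))).const_mul _).sub
      (e2.sub_const _)
  have hm : MonotoneOn h (Set.Ici a) := by
    apply monotoneOn_of_deriv_nonneg (convex_Ici a)
    · apply Continuous.continuousOn
      have c1 : Continuous fun x : ℝ => x ^ q := Real.continuous_rpow_const (by linarith)
      have c2 : Continuous fun x : ℝ => x ^ (q + 1) := Real.continuous_rpow_const (by linarith)
      fun_prop
    · rw [interior_Ici]
      exact fun x hx => (hd x hx).differentiableAt.differentiableWithinAt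
    · rw [interior_Ici]
      intro x hx
      rw [(hd x hx).deriv]
      have hx0 : 0 < x := lt_of_le_of_lt ha hx
      have hb := one_add_mul_self_le_rpow_one_add (s := a / x - 1) (p := q)
        (by have := div_nonneg ha hx0.le; linarith) hq
      have e : (1 + (a / x - 1)) ^ q = a ^ q / x ^ q := by
        rw [← Real.div_rpow ha hx0.le]; congr 1; ring
      rw [e] at hb
      have hxq : 0 < x ^ q := Real.rpow_pos_of_pos hx0 q
      have hxq1 : x ^ (q - 1) = x ^ q / x := by rw [Real.rpow_sub_one hx0.ne']
      have hb2 : (1 + q * (a / x - 1)) * x ^ q ≤ a ^ q := by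
        rwa [le_div_iff₀ hxq] at hb
      rw [hxq1, add_sub_cancel_right]
      have e3 : (x - a) * (q * (x ^ q / x)) = q * (1 - a / x) * x ^ q := by
        field_simp
      rw [e3]
      nlinarith
  have := hm (Set.mem_Ici.mpr le_rfl) (Set.mem_Ici.mpr hab) hab
  simp only [h] at this
  simp at this
  linarith

lemma mean_value_ineq_aux {t : ℝ} (ht : 3 / 2 ≤ t) {a b : ℝ} (hab : a ≤ b) :
    phiF t b - phiF t a ≤ (2 * t - 1) / 2 * ((b - a) * (psiF t a + psiF t b)) := by
  have hpow : ∀ x : ℝ, 0 ≤ x → x ^ (2 * t - 2 + 1) = x * x ^ (2 * t - 2) := fun x hx => by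
    rw [Real.rpow_add_one' hx (by linarith), mul_comm]
  unfold phiF psiF
  rcases le_total 0 a with ha | ha
  · have := hh_pos (q := 2 * t - 2) (by linarith) ha hab
    rw [hpow a ha, hpow b (ha.trans hab)] at this
    rw [abs_of_nonneg ha, abs_of_nonneg (ha.trans hab)]
    linarith
  · rcases le_total 0 b with hb | hb
    · rw [abs_of_nonneg hb]
      have h1 : 0 ≤ |a| ^ (2 * t - 2) := Real.rpow_nonneg (abs_nonneg _) _
      have h2 : 0 ≤ b ^ (2 * t - 2) := Real.rpow_nonneg hb _
      have h3 : b * b ^ (2 * t - 2) - a * |a| ^ (2 * t - 2)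
          ≤ (b - a) * (|a| ^ (2 * t - 2) + b ^ (2 * t - 2)) := by nlinarith
      have h4 : 0 ≤ (b - a) * (|a| ^ (2 * t - 2) + b ^ (2 * t - 2)) :=
        mul_nonneg (by linarith) (by linarith)
      nlinarith
    · have := hh_pos (q := 2 * t - 2) (by linarith) (neg_nonneg.mpr hb) (neg_le_neg hab)
      rw [hpow (-a) (by linarith), hpow (-b) (by linarith)] at this
      rw [abs_of_nonpos ha, abs_of_nonpos hb]
      linarith

lemma mean_value_ineq {t : ℝ} (ht : t = 1 ∨ 3 / 2 ≤ t) (a b : ℝ) :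
    (a - b) * (phiF t a - phiF t b)
      ≤ (2 * t - 1) / 2 * ((a - b) ^ 2 * (psiF t a + psiF t b)) := by
  rcases ht with rfl | ht
  · simp [phiF, psiF]; nlinarith
  · rcases le_total a b with h | h
    · have := mul_le_mul_of_nonneg_left (mean_value_ineq_aux ht h) (sub_nonneg.mpr h)
      linarith
    · have := mul_le_mul_of_nonneg_left (mean_value_ineq_aux ht h) (sub_nonneg.mpr h)
      linarith

lemma psi_sq_le {t : ℝ} (ht : 1 ≤ t) (a b : ℝ) :
    psiF t a * b ^ 2 ≤ absP (2 * t) a + absP (2 * t) b := by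
  have key : ∀ x, absP (2 * t) x = psiF t x * x ^ 2 := fun x => by
    rw [absP_eq ht, phiF]; ring
  have h1 := absP_nonneg (2 * t) a
  have h2 := absP_nonneg (2 * t) b
  rcases le_total |a| |b| with h | h
  · have : psiF t a ≤ psiF t b := Real.rpow_le_rpow (abs_nonneg _) h (by linarith)
    have := mul_le_mul_of_nonneg_right this (sq_nonneg b)
    rw [key b]; linarith
  · have : b ^ 2 ≤ a ^ 2 := sq_le_sq.mpr h
    have := mul_le_mul_of_nonneg_left this (psiF_nonneg t a)
    rw [key a]; linarith

lemma phi_mul_le {t : ℝ} (ht : 1 ≤ t) (a b : ℝ) :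
    |phiF t a * b| ≤ absP (2 * t) a + absP (2 * t) b := by
  have key : ∀ x, absP (2 * t) x = psiF t x * x ^ 2 := fun x => by
    rw [absP_eq ht, phiF]; ring
  have h := psi_sq_le ht a b
  have h1 := key a
  have h2 := absP_nonneg (2 * t) b
  have h0 := psiF_nonneg t a
  have : |phiF t a * b| = psiF t a * |a * b| := by
    rw [phiF, show a * psiF t a * b = psiF t a * (a * b) by ring, abs_mul, abs_of_nonneg h0]
  rw [this]
  have h3 : |a * b| ≤ (a ^ 2 + b ^ 2) / 2 := by
    rw [abs_mul]; nlinarith [sq_nonneg (|a| - |b|), sq_abs a, sq_abs b]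
  have := mul_le_mul_of_nonneg_left h3 h0
  linarith

lemma young_ineq {t : ℝ} (ht : 1 ≤ t) (a v : ℝ) :
    (2 * t - 1) * (psiF t a * v) ≤
      t⁻¹ * (2 * t - 1) ^ t * absP t v + (1 - t⁻¹) * absP (2 * t) a := by
  have ht0 : 0 < t := by linarith
  have hinv : t⁻¹ ≤ 1 := inv_le_one_of_one_le₀ ht
  have := Real.geom_mean_le_arith_mean2_weighted (w₁ := t⁻¹) (w₂ := 1 - t⁻¹)
    (p₁ := ((2 * t - 1) * |v|) ^ t) (p₂ := |a| ^ (2 * t)) (by positivity) (by linarith)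
    (Real.rpow_nonneg (mul_nonneg (by linarith) (abs_nonneg _)) _)
    (Real.rpow_nonneg (abs_nonneg _) _) (by ring)
  rw [← Real.rpow_mul (mul_nonneg (by linarith) (abs_nonneg _)), mul_inv_cancel₀ ht0.ne',
    Real.rpow_one, ← Real.rpow_mul (abs_nonneg _),
    show 2 * t * (1 - t⁻¹) = 2 * t - 2 by field_simp,
    Real.mul_rpow (by linarith) (abs_nonneg _)] at this
  have h0 := psiF_nonneg t a
  have h1 : (2 * t - 1) * (psiF t a * v) ≤ (2 * t - 1) * |v| * |a| ^ (2 * t - 2) := by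
    change _ ≤ (2 * t - 1) * |v| * psiF t a
    have := mul_le_mul_of_nonneg_left (le_abs_self v) h0
    have := mul_le_mul_of_nonneg_left this (show 0 ≤ 2 * t - 1 by linarith)
    linarith
  unfold absP
  linarith

lemma const_ineq {t : ℝ} (ht : 1 ≤ t) :
    (Real.pi ^ 2 / 4 * (2 * t - 1)) ^ t ≤ 2 * (Real.sqrt 2 * t) ^ (2 * t) := by
  have ht0 : 0 < t := by linarith
  have e : (Real.sqrt 2 * t) ^ (2 * t) = (2 * t ^ 2) ^ t := by
    rw [Real.rpow_mul (by positivity), Real.rpow_two, mul_pow, Real.sq_sqrt (by norm_num)]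
  rw [e]
  have hpi : Real.pi ^ 2 / 8 ≤ 5 / 4 := by
    have := Real.pi_lt_d2; have := Real.pi_pos; nlinarith
  set r : ℝ := Real.pi ^ 2 / 8 * ((2 * t - 1) / t ^ 2) with hr
  have e2 : Real.pi ^ 2 / 4 * (2 * t - 1) = r * (2 * t ^ 2) := by
    rw [hr]; field_simp; ring
  have hq0 : 0 ≤ (2 * t - 1) / t ^ 2 := div_nonneg (by linarith) (by positivity)
  have hr0 : 0 ≤ r := mul_nonneg (by positivity) hq0
  rw [e2, Real.mul_rpow hr0 (by positivity)]
  refine mul_le_mul_of_nonneg_right ?_ (by positivity)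
  rcases le_total t 2 with h | h
  · have hq1 : (2 * t - 1) / t ^ 2 ≤ 1 := by
      rw [div_le_one (by positivity)]; nlinarith [sq_nonneg (t - 1)]
    have : r ≤ 5 / 4 := by
      calc r ≤ 5 / 4 * 1 := mul_le_mul hpi hq1 hq0 (by norm_num)
        _ = _ := by norm_num
    calc r ^ t ≤ (5 / 4) ^ t := Real.rpow_le_rpow hr0 this ht0.le
      _ ≤ (5 / 4) ^ (2 : ℝ) := Real.rpow_le_rpow_of_exponent_le (by norm_num) h
      _ ≤ 2 := by norm_num
  · have hq1 : (2 * t - 1) / t ^ 2 ≤ 3 / 4 := by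
      rw [div_le_iff₀ (by positivity)]; nlinarith
    have : r ≤ 1 := by
      calc r ≤ 5 / 4 * (3 / 4) := mul_le_mul hpi hq1 hq0 (by norm_num)
        _ ≤ _ := by norm_num
    have := Real.rpow_le_one hr0 this ht0.le
    linarith

end ScalarTools

section GaussianTools

/-- Standard Gaussian measure on `Fin n → ℝ`. -/
noncomputable abbrev gm (n : ℕ) : Measure (Fin n → ℝ) := Measure.pi fun _ => gaussianReal 0 1

lemma isGaussian_gm (n : ℕ) : IsGaussian (gm n) := by
  have h : (gm n).map (EuclideanSpace.equiv (Fin n) ℝ).symm = stdGaussian _ :=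
    map_pi_eq_stdGaussian (ι := Fin n)
  rw [← isGaussian_map_equiv_iff (EuclideanSpace.equiv (Fin n) ℝ).symm, h]
  infer_instance

lemma gm_integrable_coord {n : ℕ} (i : Fin n) : Integrable (fun y : Fin n → ℝ => y i) (gm n) := by
  have := isGaussian_gm n
  exact IsGaussian.integrable_dual (gm n) (ContinuousLinearMap.proj (R := ℝ) (φ := fun _ => ℝ) i)

lemma gm_integral_coord {n : ℕ} (i : Fin n) : ∫ y : Fin n → ℝ, y i ∂(gm n) = 0 := by
  have h := (measurePreserving_eval (fun _ : Fin n => gaussianReal 0 1) i).map_eq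
  have : ∫ x, x ∂(gaussianReal 0 1) = ∫ y : Fin n → ℝ, y i ∂(gm n) := by
    conv_lhs => rw [← h]
    rw [integral_map (measurable_pi_apply i).aemeasurable (by fun_prop)]
  rw [← this]; simp

lemma gm_integrable_coord_mul {n : ℕ} (i j : Fin n) :
    Integrable (fun y : Fin n → ℝ => y i * y j) (gm n) := by
  have := isGaussian_gm n
  exact MemLp.integrable_mul (p := 2) (q := 2)
    (IsGaussian.memLp_dual (gm n) (ContinuousLinearMap.proj (R := ℝ) (φ := fun _ => ℝ) i) 2 (by simp))
    (IsGaussian.memLp_dual (gm n) (ContinuousLinearMap.proj (R := ℝ) (φ := fun _ => ℝ) j) 2 (by simp))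

lemma gm_integral_coord_mul {n : ℕ} (i j : Fin n) :
    ∫ y : Fin n → ℝ, y i * y j ∂(gm n) = if i = j then 1 else 0 := by
  split_ifs with hij
  · subst hij
    have h := (measurePreserving_eval (fun _ : Fin n => gaussianReal 0 1) i).map_eq
    have : ∫ x, x * x ∂(gaussianReal 0 1) = ∫ y : Fin n → ℝ, y i * y i ∂(gm n) := by
      conv_lhs => rw [← h]
      rw [integral_map (measurable_pi_apply i).aemeasurable (by fun_prop)]
    rw [← this]
    have hv := variance_id_gaussianReal (μ := 0) (v := 1)
    rw [variance_of_integral_eq_zero (by fun_prop) (by simp)] at hv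
    simpa [sq] using hv
  · have hind := (iIndepFun_pi (μ := fun _ : Fin n => gaussianReal 0 1)
      (X := fun _ x => x) (fun _ => by fun_prop)).indepFun hij
    have := hind.integral_fun_mul_eq_mul_integral
      (measurable_pi_apply i).aestronglyMeasurable (measurable_pi_apply j).aestronglyMeasurable
    rw [this, gm_integral_coord, zero_mul]

lemma gm_rot (n : ℕ) (θ : ℝ) :
    MeasurePreserving (ContinuousLinearMap.rotation (E := Fin n → ℝ) θ)
      ((gm n).prod (gm n)) ((gm n).prod (gm n)) := by
  have := isGaussian_gm n
  refine ⟨by fun_prop, ?_⟩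
  refine IsGaussian.map_rotation_eq_self ?_ θ
  ext i
  have hi : Integrable (fun x : Fin n → ℝ => x) (gm n) := IsGaussian.integrable_id
  have := (ContinuousLinearMap.proj (R := ℝ) (φ := fun _ : Fin n => ℝ) i).integral_comp_comm hi
  simp only [id, Pi.zero_apply]
  rw [← gm_integral_coord i]
  exact this.symm

end GaussianTools

section NCK

variable {m : Type*} [Fintype m] [DecidableEq m]

lemma PP_le {A B : Matrix m m ℝ} (hA : A.IsHermitian) (hB : B.IsHermitian) {t : ℝ}
    (ht : t = 1 ∨ 3 / 2 ≤ t) :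
    trf (absP (2 * t)) A + trf (absP (2 * t)) B - (cfc (phiF t) A * B).trace
      - (cfc (phiF t) B * A).trace ≤
    (2 * t - 1) / 2 * (trf (absP (2 * t)) A + trf (absP (2 * t)) B
      - 2 * (cfc (phiF t) A * B).trace - 2 * (cfc (phiF t) B * A).trace
      + (cfc (psiF t) A * (B * B)).trace + (cfc (psiF t) B * (A * A)).trace) := by
  have ht1 : 1 ≤ t := by rcases ht with h | h <;> linarith
  obtain ⟨a, b, w, hw, H⟩ := dsum hA hB
  have e1 : trf (absP (2 * t)) A = ∑ i, ∑ j, w i j * absP (2 * t) (a i) := by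
    have := H (absP (2 * t)) (fun _ => 1)
    rw [cfc_one_mat hB, Matrix.mul_one] at this
    simpa [trf] using this
  have e2 : trf (absP (2 * t)) B = ∑ i, ∑ j, w i j * absP (2 * t) (b j) := by
    have := H (fun _ => 1) (absP (2 * t))
    rw [cfc_one_mat hA, Matrix.one_mul] at this
    simpa [trf] using this
  have e3 : (cfc (phiF t) A * B).trace = ∑ i, ∑ j, w i j * (phiF t (a i) * b j) := by
    have := H (phiF t) (fun x => x)
    rwa [cfc_id_mat hB] at this
  have e4 : (cfc (phiF t) B * A).trace = ∑ i, ∑ j, w i j * (a i * phiF t (b j)) := by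
    have := H (fun x => x) (phiF t)
    rwa [cfc_id_mat hA, Matrix.trace_mul_comm] at this
  have e5 : (cfc (psiF t) A * (B * B)).trace = ∑ i, ∑ j, w i j * (psiF t (a i) * (b j * b j)) := by
    have := H (psiF t) (fun x => x * x)
    rwa [cfc_mul_mat, cfc_id_mat hB] at this
  have e6 : (cfc (psiF t) B * (A * A)).trace = ∑ i, ∑ j, w i j * (a i * a i * psiF t (b j)) := by
    have := H (fun x => x * x) (psiF t)
    rwa [cfc_mul_mat, cfc_id_mat hA, Matrix.trace_mul_comm] at this
  rw [e1, e2, e3, e4, e5, e6]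
  simp only [Finset.mul_sum, ← Finset.sum_add_distrib, ← Finset.sum_sub_distrib]
  refine Finset.sum_le_sum fun i _ => Finset.sum_le_sum fun j _ => ?_
  have h := mul_le_mul_of_nonneg_left (mean_value_ineq ht (a i) (b j)) (hw i j)
  rw [absP_eq ht1, absP_eq ht1]
  unfold phiF at *
  linarith

lemma RR_bound {A B : Matrix m m ℝ} (hA : A.IsHermitian) (hB : B.IsHermitian) {t : ℝ}
    (ht : 1 ≤ t) :
    |(cfc (phiF t) A * B).trace| ≤ trf (absP (2 * t)) A + trf (absP (2 * t)) B := by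
  obtain ⟨a, b, w, hw, H⟩ := dsum hA hB
  have e1 : trf (absP (2 * t)) A = ∑ i, ∑ j, w i j * absP (2 * t) (a i) := by
    have := H (absP (2 * t)) (fun _ => 1)
    rw [cfc_one_mat hB, Matrix.mul_one] at this
    simpa [trf] using this
  have e2 : trf (absP (2 * t)) B = ∑ i, ∑ j, w i j * absP (2 * t) (b j) := by
    have := H (fun _ => 1) (absP (2 * t))
    rw [cfc_one_mat hA, Matrix.one_mul] at this
    simpa [trf] using this
  have e3 : (cfc (phiF t) A * B).trace = ∑ i, ∑ j, w i j * (phiF t (a i) * b j) := by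
    have := H (phiF t) (fun x => x)
    rwa [cfc_id_mat hB] at this
  rw [e1, e2, e3]
  simp only [← Finset.sum_add_distrib]
  refine (Finset.abs_sum_le_sum_abs _ _).trans (Finset.sum_le_sum fun i _ =>
    (Finset.abs_sum_le_sum_abs _ _).trans (Finset.sum_le_sum fun j _ => ?_))
  rw [abs_mul, abs_of_nonneg (hw i j), ← mul_add]
  exact mul_le_mul_of_nonneg_left (phi_mul_le ht _ _) (hw i j)

lemma QQ_bound {A B : Matrix m m ℝ} (hA : A.IsHermitian) (hB : B.IsHermitian) {t : ℝ}
    (ht : 1 ≤ t) :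
    |(cfc (psiF t) A * (B * B)).trace| ≤ trf (absP (2 * t)) A + trf (absP (2 * t)) B := by
  obtain ⟨a, b, w, hw, H⟩ := dsum hA hB
  have e1 : trf (absP (2 * t)) A = ∑ i, ∑ j, w i j * absP (2 * t) (a i) := by
    have := H (absP (2 * t)) (fun _ => 1)
    rw [cfc_one_mat hB, Matrix.mul_one] at this
    simpa [trf] using this
  have e2 : trf (absP (2 * t)) B = ∑ i, ∑ j, w i j * absP (2 * t) (b j) := by
    have := H (fun _ => 1) (absP (2 * t))
    rw [cfc_one_mat hA, Matrix.one_mul] at this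
    simpa [trf] using this
  have e5 : (cfc (psiF t) A * (B * B)).trace = ∑ i, ∑ j, w i j * (psiF t (a i) * (b j * b j)) := by
    have := H (psiF t) (fun x => x * x)
    rwa [cfc_mul_mat, cfc_id_mat hB] at this
  rw [e1, e2, e5]
  simp only [← Finset.sum_add_distrib]
  refine (Finset.abs_sum_le_sum_abs _ _).trans (Finset.sum_le_sum fun i _ =>
    (Finset.abs_sum_le_sum_abs _ _).trans (Finset.sum_le_sum fun j _ => ?_))
  rw [abs_mul, abs_of_nonneg (hw i j), ← mul_add]
  refine mul_le_mul_of_nonneg_left ?_ (hw i j)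
  rw [abs_of_nonneg (mul_nonneg (psiF_nonneg _ _) (mul_self_nonneg _)), ← sq]
  exact psi_sq_le ht _ _

lemma young_trace {A V : Matrix m m ℝ} (hA : A.IsHermitian) (hV : V.IsHermitian) {t : ℝ}
    (ht : 1 ≤ t) :
    (2 * t - 1) * (cfc (psiF t) A * V).trace ≤
      t⁻¹ * (2 * t - 1) ^ t * trf (absP t) V + (1 - t⁻¹) * trf (absP (2 * t)) A := by
  obtain ⟨a, b, w, hw, H⟩ := dsum hA hV
  have e1 : trf (absP (2 * t)) A = ∑ i, ∑ j, w i j * absP (2 * t) (a i) := by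
    have := H (absP (2 * t)) (fun _ => 1)
    rw [cfc_one_mat hV, Matrix.mul_one] at this
    simpa [trf] using this
  have e2 : trf (absP t) V = ∑ i, ∑ j, w i j * absP t (b j) := by
    have := H (fun _ => 1) (absP t)
    rw [cfc_one_mat hA, Matrix.one_mul] at this
    simpa [trf] using this
  have e3 : (cfc (psiF t) A * V).trace = ∑ i, ∑ j, w i j * (psiF t (a i) * b j) := by
    have := H (psiF t) (fun x => x)
    rwa [cfc_id_mat hV] at this
  rw [e1, e2, e3]
  simp only [Finset.mul_sum, ← Finset.sum_add_distrib]
  refine Finset.sum_le_sum fun i _ => Finset.sum_le_sum fun j _ => ?_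
  have h := mul_le_mul_of_nonneg_left (young_ineq ht (a i) (b j)) (hw i j)
  linarith

open scoped Matrix.Norms.L2Operator in
lemma trf_absP_le {p : ℝ} (hp : 0 ≤ p) {A : Matrix m m ℝ} (hA : A.IsHermitian) :
    trf (absP p) A ≤ Fintype.card m * ‖A‖ ^ p := by
  rw [trf_eq hA]
  calc _ ≤ ∑ _i : m, ‖A‖ ^ p := Finset.sum_le_sum fun i _ => ?_
    _ = _ := by simp
  refine Real.rpow_le_rpow (abs_nonneg _) ?_ hp
  have : Nonempty m := ⟨i⟩
  exact spectrum.norm_le_norm_of_mem (hA.eigenvalues_mem_spectrum_real i)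

/-- The matrix Gaussian series. -/
noncomputable def gser {n : ℕ} (H : Fin n → Matrix m m ℝ) (y : Fin n → ℝ) : Matrix m m ℝ :=
  ∑ i, y i • H i

lemma gser_herm {n : ℕ} {H : Fin n → Matrix m m ℝ} (hH : ∀ i, (H i).IsHermitian)
    (y : Fin n → ℝ) : (gser H y).IsHermitian := by
  have h : ∀ i, (H i)ᵀ = H i := fun i => by simpa using (hH i).eq
  simp [IsHermitian, gser, Matrix.transpose_sum, h]

lemma continuous_gser {n : ℕ} (H : Fin n → Matrix m m ℝ) : Continuous (gser H) := by
  unfold gser; fun_prop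

lemma gser_lin {n : ℕ} (H : Fin n → Matrix m m ℝ) (c s : ℝ) (x y : Fin n → ℝ) :
    gser H (c • x + s • y) = c • gser H x + s • gser H y := by
  simp [gser, add_smul, Finset.sum_add_distrib, Finset.smul_sum, smul_smul]

open scoped Matrix.Norms.L2Operator in
lemma gser_integrable {n : ℕ} {H : Fin n → Matrix m m ℝ} (hH : ∀ i, (H i).IsHermitian)
    {p : ℝ} (hp : 0 < p) : Integrable (fun y => trf (absP p) (gser H y)) (gm n) := by
  have := isGaussian_gm n
  have h1 := (IsGaussian.memLp_id (gm n) (ENNReal.ofReal p) (by simp)).integrable_norm_rpow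
    (by simpa using hp) (by simp)
  rw [ENNReal.toReal_ofReal hp.le] at h1
  set C := ∑ i, ‖H i‖
  refine (h1.const_mul (Fintype.card m * C ^ p)).mono'
    (continuous_trf (continuous_absP hp.le) (continuous_gser H)
      (gser_herm hH)).aestronglyMeasurable (ae_of_all _ fun y => ?_)
  have hC : 0 ≤ C := Finset.sum_nonneg fun i _ => norm_nonneg _
  have hn : ‖gser H y‖ ≤ C * ‖y‖ := by
    refine (norm_sum_le _ _).trans ?_
    rw [Finset.sum_mul]
    refine Finset.sum_le_sum fun i _ => ?_
    rw [norm_smul, mul_comm]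
    exact mul_le_mul_of_nonneg_left (norm_le_pi_norm y i) (norm_nonneg _)
  rw [Real.norm_of_nonneg (trf_nonneg (absP_nonneg p) (gser_herm hH y))]
  refine (trf_absP_le hp.le (gser_herm hH y)).trans ?_
  rw [mul_assoc, id, ← Real.mul_rpow hC (norm_nonneg _)]
  exact mul_le_mul_of_nonneg_left (Real.rpow_le_rpow (norm_nonneg _) hn hp.le) (by positivity)

lemma trace_phi_self {A : Matrix m m ℝ} (hA : A.IsHermitian) {t : ℝ} (ht : 1 ≤ t) :
    (cfc (phiF t) A * A).trace = trf (absP (2 * t)) A := by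
  have : absP (2 * t) = fun x => phiF t x * x := by
    ext x; rw [absP_eq ht, mul_comm]
  rw [trf, this, cfc_mul_mat, cfc_id_mat hA]

lemma trace_psi_self {A : Matrix m m ℝ} (hA : A.IsHermitian) {t : ℝ} (ht : 1 ≤ t) :
    (cfc (psiF t) A * (A * A)).trace = trf (absP (2 * t)) A := by
  have : absP (2 * t) = fun x => psiF t x * (x * x) := by
    ext x; rw [absP_eq ht, phiF]; ring
  rw [trf, this, cfc_mul_mat, cfc_mul_mat, cfc_id_mat hA]

lemma trace_mul_gser {n : ℕ} (M : Matrix m m ℝ) (H : Fin n → Matrix m m ℝ) (y : Fin n → ℝ) :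
    (M * gser H y).trace = ∑ i, y i * (M * H i).trace := by
  simp [gser, Matrix.mul_sum, Matrix.trace_sum]

lemma trace_mul_gser_sq {n : ℕ} (M : Matrix m m ℝ) (H : Fin n → Matrix m m ℝ) (y : Fin n → ℝ) :
    (M * (gser H y * gser H y)).trace = ∑ i, ∑ j, y i * y j * (M * (H i * H j)).trace := by
  simp only [gser, Matrix.mul_sum, Matrix.sum_mul, Matrix.trace_sum, Matrix.smul_mul,
    Matrix.mul_smul, Matrix.trace_smul, smul_eq_mul, Finset.mul_sum]
  rw [Finset.sum_comm]
  refine Finset.sum_congr rfl fun i _ => Finset.sum_congr rfl fun j _ => by ring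

lemma integral_trace_gser {n : ℕ} (M : Matrix m m ℝ) (H : Fin n → Matrix m m ℝ) :
    ∫ y, (M * gser H y).trace ∂(gm n) = 0 := by
  simp only [trace_mul_gser]
  rw [integral_finsetSum _ fun i _ => (gm_integrable_coord i).mul_const _]
  simp [integral_mul_const, gm_integral_coord]

lemma integrable_trace_gser {n : ℕ} (M : Matrix m m ℝ) (H : Fin n → Matrix m m ℝ) :
    Integrable (fun y => (M * gser H y).trace) (gm n) := by
  simp only [trace_mul_gser]
  exact integrable_finsetSum _ fun i _ => (gm_integrable_coord i).mul_const _

lemma integrable_trace_gser_sq {n : ℕ} (M : Matrix m m ℝ) (H : Fin n → Matrix m m ℝ) :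
    Integrable (fun y => (M * (gser H y * gser H y)).trace) (gm n) := by
  simp only [trace_mul_gser_sq]
  exact integrable_finsetSum _ fun i _ => integrable_finsetSum _ fun j _ =>
    (gm_integrable_coord_mul i j).mul_const _

lemma integral_trace_gser_sq {n : ℕ} (M : Matrix m m ℝ) (H : Fin n → Matrix m m ℝ) :
    ∫ y, (M * (gser H y * gser H y)).trace ∂(gm n) = (M * ∑ i, H i * H i).trace := by
  simp only [trace_mul_gser_sq]
  rw [integral_finsetSum _ fun i _ => integrable_finsetSum _ fun j _ =>
    (gm_integrable_coord_mul i j).mul_const _, Matrix.mul_sum, Matrix.trace_sum]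
  refine Finset.sum_congr rfl fun i _ => ?_
  rw [integral_finsetSum _ fun j _ => (gm_integrable_coord_mul i j).mul_const _]
  simp [integral_mul_const, gm_integral_coord_mul]

lemma inner_R {n : ℕ} {H : Fin n → Matrix m m ℝ} (hH : ∀ i, (H i).IsHermitian) {t : ℝ}
    (ht : 1 ≤ t) (c s : ℝ) (x : Fin n → ℝ) :
    ∫ y, (cfc (phiF t) (gser H x) * gser H (c • x + s • y)).trace ∂(gm n)
      = c * trf (absP (2 * t)) (gser H x) := by
  simp only [gser_lin, Matrix.mul_add, Matrix.mul_smul, Matrix.trace_add, Matrix.trace_smul,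
    trace_phi_self (gser_herm hH x) ht]
  simp only [smul_eq_mul]
  rw [integral_add (integrable_const _) ((integrable_trace_gser _ _).const_mul s)]
  simp [integral_const_mul, integral_trace_gser]

lemma inner_Q {n : ℕ} {H : Fin n → Matrix m m ℝ} (hH : ∀ i, (H i).IsHermitian) {t : ℝ}
    (ht : 1 ≤ t) (c s : ℝ) (x : Fin n → ℝ) :
    ∫ y, (cfc (psiF t) (gser H x) * (gser H (c • x + s • y) * gser H (c • x + s • y))).trace ∂(gm n)
      = c ^ 2 * trf (absP (2 * t)) (gser H x)
        + s ^ 2 * (cfc (psiF t) (gser H x) * ∑ i, H i * H i).trace := by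
  generalize hAe : gser H x = A
  have hA : A.IsHermitian := hAe ▸ gser_herm hH x
  generalize hMe : cfc (psiF t) A = M
  have e : ∀ y, (M * (gser H (c • x + s • y) * gser H (c • x + s • y))).trace
      = c ^ 2 * trf (absP (2 * t)) A + (c * s) * ((M * A + A * M) * gser H y).trace
        + s ^ 2 * (M * (gser H y * gser H y)).trace := by
    intro y
    rw [gser_lin, ← trace_psi_self hA ht, hAe, hMe]
    have : (A * (M * gser H y)).trace = (M * (gser H y * A)).trace := by
      rw [Matrix.trace_mul_comm, Matrix.mul_assoc]
    simp only [Matrix.add_mul, Matrix.mul_add, Matrix.trace_add, Matrix.smul_mul,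
      Matrix.mul_smul, Matrix.trace_smul, smul_eq_mul, Matrix.mul_assoc, this]
    ring
  simp only [e]
  have i1 : Integrable (fun y => c ^ 2 * trf (absP (2 * t)) A
      + (c * s) * ((M * A + A * M) * gser H y).trace) (gm n) :=
    (integrable_const _).add ((integrable_trace_gser _ _).const_mul _)
  rw [integral_add i1 ((integrable_trace_gser_sq _ _).const_mul _), integral_add (integrable_const _) ((integrable_trace_gser _ _).const_mul _)]
  simp [integral_const_mul, integral_trace_gser, integral_trace_gser_sq]

end NCK

section NCKmain

variable {m : Type*} [Fintype m] [DecidableEq m]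

lemma nck_step {n : ℕ} {H : Fin n → Matrix m m ℝ} (hH : ∀ i, (H i).IsHermitian) {t : ℝ}
    (ht : t = 1 ∨ 3 / 2 ≤ t)
    (iK : Integrable (fun x => (cfc (psiF t) (gser H x) * ∑ i, H i * H i).trace) (gm n)) (θ : ℝ) :
    2 * (1 - Real.cos θ) * ∫ y, trf (absP (2 * t)) (gser H y) ∂(gm n) ≤
    (2 * t - 1) / 2 * (2 * (1 - Real.cos θ) ^ 2 * ∫ y, trf (absP (2 * t)) (gser H y) ∂(gm n)
      + 2 * (1 - Real.cos θ) * (1 + Real.cos θ) *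
        ∫ y, (cfc (psiF t) (gser H y) * ∑ i, H i * H i).trace ∂(gm n)) := by
  have ht1 : 1 ≤ t := by rcases ht with h | h <;> linarith
  have hG := isGaussian_gm n
  set c := Real.cos θ
  set s := Real.sin θ
  have hcs : s ^ 2 = (1 - c) * (1 + c) := by
    have := Real.sin_sq_add_cos_sq θ
    change s ^ 2 + c ^ 2 = 1 at this
    linarith
  set ν := (gm n).prod (gm n)
  have hrot := gm_rot n θ
  set ρ := ContinuousLinearMap.rotation (E := Fin n → ℝ) θ
  have hmap : Measure.map ρ ν = ν := hrot.map_eq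
  have hρ1 : ∀ z, (ρ z).1 = c • z.1 + s • z.2 := fun z => rfl
  have hρ2 : ∀ z : (Fin n → ℝ) × (Fin n → ℝ), z.1 = c • (ρ z).1 + (-s) • (ρ z).2 := fun z => by
    have h2 : (ρ z).2 = -s • z.1 + c • z.2 := rfl
    rw [hρ1, h2]
    have : c ^ 2 + s ^ 2 = 1 := by rw [hcs]; ring
    ext i
    simp
    linear_combination (-(z.1 i)) * this
  have hh := gser_herm hH
  have hcg := continuous_gser H
  have hcφ : Continuous fun z => cfc (phiF t) (gser H z) :=
    continuous_cfc_mat (continuous_phiF ht1) hcg hh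
  have hcψ : Continuous fun z => cfc (psiF t) (gser H z) :=
    continuous_cfc_mat (continuous_psiF ht1) hcg hh
  have hcP : Continuous fun z => trf (absP (2 * t)) (gser H z) :=
    continuous_trf (continuous_absP (by linarith)) hcg hh
  have iP : Integrable (fun y => trf (absP (2 * t)) (gser H y)) (gm n) :=
    gser_integrable hH (by linarith)
  set P := ∫ y, trf (absP (2 * t)) (gser H y) ∂(gm n) with hPdef
  set K := ∫ y, (cfc (psiF t) (gser H y) * ∑ i, H i * H i).trace ∂(gm n) with hKdef
  -- general rotation facts
  have rotI : ∀ G : (Fin n → ℝ) × (Fin n → ℝ) → ℝ, Continuous G →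
      ∫ z, G (ρ z) ∂ν = ∫ z, G z ∂ν := fun G hGc => by
    conv_rhs => rw [← hmap]
    rw [integral_map hrot.measurable.aemeasurable hGc.aestronglyMeasurable]
  have iA : Integrable (fun z : (Fin n → ℝ) × (Fin n → ℝ) => trf (absP (2 * t)) (gser H z.1)) ν :=
    iP.comp_fst _
  have iB : Integrable (fun z => trf (absP (2 * t)) (gser H (ρ z).1)) ν :=
    hrot.integrable_comp_of_integrable iA
  have vA : ∫ z : (Fin n → ℝ) × (Fin n → ℝ), trf (absP (2 * t)) (gser H z.1) ∂ν = P := by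
    rw [integral_prod _ iA]; simp [hPdef]
  have vB : ∫ z, trf (absP (2 * t)) (gser H (ρ z).1) ∂ν = P := by
    rw [rotI (fun z => trf (absP (2 * t)) (gser H z.1)) (hcP.comp continuous_fst), vA]
  -- general integrability, for any direction
  have cont_lin : ∀ u : ℝ, Continuous fun z : (Fin n → ℝ) × (Fin n → ℝ) =>
      gser H (c • z.1 + u • z.2) := fun u => hcg.comp (by fun_prop)
  have conR : ∀ u : ℝ, Continuous fun z : (Fin n → ℝ) × (Fin n → ℝ) =>
      (cfc (phiF t) (gser H z.1) * gser H (c • z.1 + u • z.2)).trace := fun u =>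
    ((hcφ.comp continuous_fst).mul (cont_lin u)).matrix_trace
  have conQ : ∀ u : ℝ, Continuous fun z : (Fin n → ℝ) × (Fin n → ℝ) =>
      (cfc (psiF t) (gser H z.1) *
        (gser H (c • z.1 + u • z.2) * gser H (c • z.1 + u • z.2))).trace := fun u =>
    ((hcψ.comp continuous_fst).mul ((cont_lin u).mul (cont_lin u))).matrix_trace
  have iR : Integrable (fun z : (Fin n → ℝ) × (Fin n → ℝ) =>
      (cfc (phiF t) (gser H z.1) * gser H (c • z.1 + s • z.2)).trace) ν :=
    (iA.add iB).mono' (conR s).aestronglyMeasurable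
      (ae_of_all _ fun z => RR_bound (hh _) (hh _) ht1)
  have iQ : Integrable (fun z : (Fin n → ℝ) × (Fin n → ℝ) => (cfc (psiF t) (gser H z.1) *
        (gser H (c • z.1 + s • z.2) * gser H (c • z.1 + s • z.2))).trace) ν :=
    (iA.add iB).mono' (conQ s).aestronglyMeasurable
      (ae_of_all _ fun z => QQ_bound (hh _) (hh _) ht1)
  have iR2 : Integrable (fun z => (cfc (phiF t) (gser H (ρ z).1) * gser H z.1).trace) ν := by
    refine (iB.add iA).mono' (Continuous.aestronglyMeasurable ?_)
      (ae_of_all _ fun z => RR_bound (hh _) (hh _) ht1)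
    exact ((hcφ.comp (continuous_fst.comp ρ.continuous)).mul
      (hcg.comp continuous_fst)).matrix_trace
  have iQ2 : Integrable (fun z => (cfc (psiF t) (gser H (ρ z).1) *
      (gser H z.1 * gser H z.1)).trace) ν := by
    refine (iB.add iA).mono' (Continuous.aestronglyMeasurable ?_)
      (ae_of_all _ fun z => QQ_bound (hh _) (hh _) ht1)
    exact ((hcψ.comp (continuous_fst.comp ρ.continuous)).mul
      ((hcg.comp continuous_fst).mul (hcg.comp continuous_fst))).matrix_trace
  have rw2 : ∀ z : (Fin n → ℝ) × (Fin n → ℝ),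
      gser H z.1 = gser H (c • (ρ z).1 + (-s) • (ρ z).2) := fun z => by rw [← hρ2 z]
  -- transfer integrability to direction `-s`
  have iRm : Integrable (fun z : (Fin n → ℝ) × (Fin n → ℝ) =>
      (cfc (phiF t) (gser H z.1) * gser H (c • z.1 + (-s) • z.2)).trace) ν := by
    rw [← hmap]
    refine (integrable_map_measure (conR (-s)).aestronglyMeasurable
      hrot.measurable.aemeasurable).mpr (iR2.congr (ae_of_all _ fun z => ?_))
    simp only [Function.comp_apply, ← hρ2]
  have iQm : Integrable (fun z : (Fin n → ℝ) × (Fin n → ℝ) => (cfc (psiF t) (gser H z.1) *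
        (gser H (c • z.1 + (-s) • z.2) * gser H (c • z.1 + (-s) • z.2))).trace) ν := by
    rw [← hmap]
    refine (integrable_map_measure (conQ (-s)).aestronglyMeasurable
      hrot.measurable.aemeasurable).mpr (iQ2.congr (ae_of_all _ fun z => ?_))
    simp only [Function.comp_apply, ← hρ2]
  have vR : ∀ u : ℝ, Integrable (fun z : (Fin n → ℝ) × (Fin n → ℝ) =>
      (cfc (phiF t) (gser H z.1) * gser H (c • z.1 + u • z.2)).trace) ν →
      ∫ z : (Fin n → ℝ) × (Fin n → ℝ),
        (cfc (phiF t) (gser H z.1) * gser H (c • z.1 + u • z.2)).trace ∂ν = c * P := fun u hi => by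
    rw [integral_prod _ hi]
    simp only [inner_R hH ht1]
    rw [integral_const_mul]
  have vQ : ∀ u : ℝ, Integrable (fun z : (Fin n → ℝ) × (Fin n → ℝ) => (cfc (psiF t) (gser H z.1) *
        (gser H (c • z.1 + u • z.2) * gser H (c • z.1 + u • z.2))).trace) ν →
      ∫ z : (Fin n → ℝ) × (Fin n → ℝ), (cfc (psiF t) (gser H z.1) *
        (gser H (c • z.1 + u • z.2) * gser H (c • z.1 + u • z.2))).trace ∂ν
        = c ^ 2 * P + u ^ 2 * K := fun u hi => by
    rw [integral_prod _ hi]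
    simp only [inner_Q hH ht1]
    rw [integral_add (iP.const_mul _) (iK.const_mul _), integral_const_mul, integral_const_mul]
  have vR2 : ∫ z, (cfc (phiF t) (gser H (ρ z).1) * gser H z.1).trace ∂ν = c * P := by
    rw [← vR (-s) iRm, ← rotI _ (conR (-s))]
    simp only [← hρ2]
  have vQ2 : ∫ z, (cfc (psiF t) (gser H (ρ z).1) * (gser H z.1 * gser H z.1)).trace ∂ν
      = c ^ 2 * P + s ^ 2 * K := by
    have := vQ (-s) iQm
    rw [← rotI _ (conQ (-s))] at this
    simp only [← hρ2, neg_sq] at this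
    exact this
  have main := integral_mono (((iA.add iB).sub iR).sub iR2)
    ((((((iA.add iB).sub (iR.const_mul 2)).sub (iR2.const_mul 2)).add iQ).add iQ2).const_mul
      ((2 * t - 1) / 2))
    (fun z => PP_le (hh z.1) (hh (ρ z).1) ht)
  rw [integral_const_mul] at main
  rw [integral_sub' ((iA.add iB).sub iR) iR2, integral_sub' (iA.add iB) iR, integral_add' iA iB,
    integral_add' ((((iA.add iB).sub (iR.const_mul 2)).sub (iR2.const_mul 2)).add iQ) iQ2,
    integral_add' (((iA.add iB).sub (iR.const_mul 2)).sub (iR2.const_mul 2)) iQ,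
    integral_sub' ((iA.add iB).sub (iR.const_mul 2)) (iR2.const_mul 2),
    integral_sub' (iA.add iB) (iR.const_mul 2), integral_add' iA iB,
    integral_const_mul, integral_const_mul, vA, vB, vR s iR, vQ s iQ, vR2, vQ2, hcs] at main
  calc _ = P + P - c * P - c * P := by ring
    _ ≤ _ := main
    _ = _ := by ring

lemma nck {n : ℕ} {H : Fin n → Matrix m m ℝ} (hH : ∀ i, (H i).IsHermitian) {t : ℝ}
    (ht : t = 1 ∨ 3 / 2 ≤ t) :
    ∫ y, trf (absP (2 * t)) (gser H y) ∂(gm n)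
      ≤ (2 * t - 1) ^ t * trf (absP t) (∑ i, H i * H i) := by
  have ht1 : 1 ≤ t := by rcases ht with h | h <;> linarith
  have hG := isGaussian_gm n
  have hh := gser_herm hH
  have hV : (∑ i, H i * H i).IsHermitian := by
    have h : ∀ i, (H i)ᵀ = H i := fun i => by simpa using (hH i).eq
    simp [IsHermitian, Matrix.transpose_sum, Matrix.transpose_mul, h]
  have iP : Integrable (fun y => trf (absP (2 * t)) (gser H y)) (gm n) :=
    gser_integrable hH (by linarith)
  have iK : Integrable (fun x => (cfc (psiF t) (gser H x) * ∑ i, H i * H i).trace) (gm n) := by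
    simp only [Matrix.mul_sum, Matrix.trace_sum]
    refine integrable_finsetSum _ fun i _ => ?_
    refine (iP.add (integrable_const (trf (absP (2 * t)) (H i)))).mono'
      (Continuous.aestronglyMeasurable ?_) (ae_of_all _ fun z => QQ_bound (hh _) (hH i) ht1)
    exact ((continuous_cfc_mat (continuous_psiF ht1) (continuous_gser H) hh).mul
      continuous_const).matrix_trace
  have step := nck_step hH ht iK
  have hKle : (2 * t - 1) * ∫ y, (cfc (psiF t) (gser H y) * ∑ i, H i * H i).trace ∂(gm n)
      ≤ t⁻¹ * (2 * t - 1) ^ t * trf (absP t) (∑ i, H i * H i)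
        + (1 - t⁻¹) * ∫ y, trf (absP (2 * t)) (gser H y) ∂(gm n) := by
    rw [← integral_const_mul]
    calc _ ≤ ∫ y, (t⁻¹ * (2 * t - 1) ^ t * trf (absP t) (∑ i, H i * H i)
        + (1 - t⁻¹) * trf (absP (2 * t)) (gser H y)) ∂(gm n) :=
          integral_mono (iK.const_mul _) ((integrable_const _).add (iP.const_mul _))
            (fun y => young_trace (hh y) hV ht1)
      _ = _ := by
          rw [integral_add (integrable_const _) (iP.const_mul _), integral_const, probReal_univ, one_smul,
            integral_const_mul]
  set P := ∫ y, trf (absP (2 * t)) (gser H y) ∂(gm n)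
  set K := ∫ y, (cfc (psiF t) (gser H y) * ∑ i, H i * H i).trace ∂(gm n)
  have hPK : P ≤ (2 * t - 1) * K := by
    have hdiv : ∀ θ : ℝ, Real.cos θ < 1 →
        P ≤ (2 * t - 1) / 2 * ((1 - Real.cos θ) * P + (1 + Real.cos θ) * K) := fun θ hθ => by
      have h := step θ
      have hpos : 0 < 2 * (1 - Real.cos θ) := by linarith
      refine le_of_mul_le_mul_left ?_ hpos
      linarith
    have hlim : Filter.Tendsto (fun k : ℕ => (2 * t - 1) / 2 *
        ((1 - Real.cos (1 / ((k : ℝ) + 1))) * P + (1 + Real.cos (1 / ((k : ℝ) + 1))) * K))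
        Filter.atTop (nhds ((2 * t - 1) / 2 * ((1 - Real.cos 0) * P + (1 + Real.cos 0) * K))) := by
      have h0 : Filter.Tendsto (fun k : ℕ => 1 / ((k : ℝ) + 1)) Filter.atTop (nhds 0) :=
        tendsto_one_div_add_atTop_nhds_zero_nat
      have hc : Continuous fun θ : ℝ => (2 * t - 1) / 2 *
        ((1 - Real.cos θ) * P + (1 + Real.cos θ) * K) := by fun_prop
      exact (hc.tendsto 0).comp h0
    have := ge_of_tendsto' hlim (fun k => hdiv _ ?_)
    · rw [Real.cos_zero] at this; linarith
    · have hk : 0 < 1 / ((k : ℝ) + 1) := by positivity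
      have hk1 : 1 / ((k : ℝ) + 1) ≤ 1 := by
        rw [div_le_one (by positivity)]; have : (0:ℝ) ≤ k := by positivity
        linarith
      have hc := Real.cos_lt_cos_of_nonneg_of_le_pi le_rfl (by linarith [Real.pi_gt_three]) hk
      rwa [Real.cos_zero] at hc
  have hfin : t⁻¹ * P ≤ t⁻¹ * ((2 * t - 1) ^ t * trf (absP t) (∑ i, H i * H i)) := by linarith
  exact le_of_mul_le_mul_left hfin (by positivity)

end NCKmain

section JensenPart

variable {m : Type*} [Fintype m] [DecidableEq m]

lemma scalar_jensen {Ω : Type*} [MeasurableSpace Ω] (ν : Measure Ω) [IsProbabilityMeasure ν]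
    {g : Ω → ℝ} (hg : Integrable g ν) {p : ℝ} (hp : 1 ≤ p) :
    ENNReal.ofReal (absP p (∫ ω, g ω ∂ν)) ≤ ∫⁻ ω, ENNReal.ofReal (absP p (g ω)) ∂ν := by
  have hp0 : 0 < p := by linarith
  have key : ∀ x : ℝ, ENNReal.ofReal (absP p x) = ‖x‖ₑ ^ p := fun x => by
    rw [absP, ← ENNReal.ofReal_rpow_of_nonneg (abs_nonneg x) hp0.le, Real.enorm_eq_ofReal_abs]
  simp only [key]
  have h1 := enorm_integral_le_lintegral_enorm (μ := ν) g
  have h2 := eLpNorm'_le_eLpNorm'_of_exponent_le (μ := ν) (f := g) zero_lt_one hp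
    hg.aestronglyMeasurable
  have h3 : ‖∫ ω, g ω ∂ν‖ₑ ≤ eLpNorm' g p ν := by
    refine h1.trans (le_trans (le_of_eq ?_) h2)
    simp [eLpNorm']
  calc ‖∫ ω, g ω ∂ν‖ₑ ^ p ≤ (eLpNorm' g p ν) ^ p := ENNReal.rpow_le_rpow h3 hp0.le
    _ = _ := by
      rw [eLpNorm', ← ENNReal.rpow_mul, one_div, inv_mul_cancel₀ hp0.ne', ENNReal.rpow_one]

lemma matIntegral_herm {Ω : Type*} [MeasurableSpace Ω] (ν : Measure Ω) {M : Ω → Matrix m m ℝ}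
    (hM : ∀ ω, (M ω).IsHermitian) : (matIntegral ν M).IsHermitian := by
  ext i j
  have : ∀ ω, M ω j i = M ω i j := fun ω => by simpa using (hM ω).apply i j
  simp [matIntegral, this]

lemma conj_apply (U N : Matrix m m ℝ) (i : m) :
    (Uᵀ * N * U) i i = ∑ k, ∑ l, U l i * U k i * N l k := by
  simp only [Matrix.mul_apply, Finset.sum_mul, Matrix.transpose_apply]
  refine Finset.sum_congr rfl fun k _ => Finset.sum_congr rfl fun l _ => by ring

lemma jensen_trf {Ω : Type*} [MeasurableSpace Ω] (ν : Measure Ω) [IsProbabilityMeasure ν]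
    {M : Ω → Matrix m m ℝ} (hM : ∀ ω, (M ω).IsHermitian)
    (hi : ∀ i j, Integrable (fun ω => M ω i j) ν) {p : ℝ} (hp : 1 ≤ p) :
    ENNReal.ofReal (trf (absP p) (matIntegral ν M)) ≤
      ∫⁻ ω, ENNReal.ofReal (trf (absP p) (M ω)) ∂ν := by
  have hh := matIntegral_herm ν hM
  obtain ⟨U, h1, h2, h3⟩ := exists_spec hh
  have hdiag : ∀ i, (Uᵀ * matIntegral ν M * U) i i = hh.eigenvalues i := fun i => by
    have e := h3 (fun x => x)
    rw [cfc_id_mat hh] at e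
    refine (congrArg (fun X => (Uᵀ * X * U) i i) e).trans ?_
    have : Uᵀ * (U * diagonal ((fun x => x) ∘ hh.eigenvalues) * Uᵀ) * U
        = (Uᵀ * U) * diagonal ((fun x => x) ∘ hh.eigenvalues) * (Uᵀ * U) := by
      simp only [Matrix.mul_assoc]
    change (Uᵀ * (U * diagonal ((fun x => x) ∘ hh.eigenvalues) * Uᵀ) * U) i i = _
    rw [this, h1]
    simp
  have hint : ∀ i, Integrable (fun ω => (Uᵀ * M ω * U) i i) ν := fun i => by
    simp only [conj_apply]
    exact integrable_finsetSum _ fun k _ => integrable_finsetSum _ fun l _ => (hi l k).const_mul _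
  have hmean : ∀ i, (Uᵀ * matIntegral ν M * U) i i = ∫ ω, (Uᵀ * M ω * U) i i ∂ν := fun i => by
    simp only [conj_apply]
    rw [integral_finsetSum _ fun k _ => integrable_finsetSum _ fun l _ => (hi l k).const_mul _]
    refine Finset.sum_congr rfl fun k _ => ?_
    rw [integral_finsetSum _ fun l _ => (hi l k).const_mul _]
    refine Finset.sum_congr rfl fun l _ => ?_
    rw [integral_const_mul]
    rfl
  rw [trf_eq hh]
  simp only [← hdiag, hmean]
  rw [ENNReal.ofReal_sum_of_nonneg fun i _ => absP_nonneg _ _]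
  calc ∑ i, ENNReal.ofReal (absP p (∫ ω, (Uᵀ * M ω * U) i i ∂ν))
      ≤ ∑ i, ∫⁻ ω, ENNReal.ofReal (absP p ((Uᵀ * M ω * U) i i)) ∂ν :=
        Finset.sum_le_sum fun i _ => scalar_jensen ν (hint i) hp
    _ = ∫⁻ ω, ∑ i, ENNReal.ofReal (absP p ((Uᵀ * M ω * U) i i)) ∂ν := by
        rw [lintegral_finsetSum']
        intro i _
        exact ((continuous_absP (by linarith)).measurable.comp_aemeasurable
          (hint i).aestronglyMeasurable.aemeasurable).ennreal_ofReal
    _ ≤ _ := by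
        refine lintegral_mono fun ω => ?_
        rw [← ENNReal.ofReal_sum_of_nonneg fun i _ => absP_nonneg _ _]
        exact ENNReal.ofReal_le_ofReal (peierls (convexOn_absP hp) (hM ω) U h1 h2)

end JensenPart

section HermitianMoments

variable {m : Type*} [Fintype m] [DecidableEq m]

/-- uniform measure on an interval -/
noncomputable def uni : Measure ℝ :=
  ENNReal.ofReal (2 / Real.pi) • (volume.restrict (Set.Ioc 0 (Real.pi / 2)))

lemma uni_prob : IsProbabilityMeasure uni := by
  constructor
  have := Real.pi_pos
  simp only [uni, Measure.smul_apply, Measure.restrict_apply_univ, Real.volume_Ioc, sub_zero,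
    smul_eq_mul]
  rw [← ENNReal.ofReal_mul (by positivity)]
  rw [show 2 / Real.pi * (Real.pi / 2) = 1 by field_simp]
  simp

lemma uni_integrable {f : ℝ → ℝ} (hf : Continuous f) : Integrable f uni :=
  (hf.integrableOn_Ioc).smul_measure ENNReal.ofReal_ne_top

lemma uni_integral (f : ℝ → ℝ) :
    ∫ θ, f θ ∂uni = 2 / Real.pi * ∫ θ in (0 : ℝ)..(Real.pi / 2), f θ := by
  have := Real.pi_pos
  rw [uni, integral_smul_measure, intervalIntegral.integral_of_le (by positivity),
    ENNReal.toReal_ofReal (by positivity), smul_eq_mul]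

/-- the rotated interpolation field -/
noncomputable def Gfld {n : ℕ} (H : (Fin n → ℝ) → Matrix m m ℝ)
    (z : (Fin n → ℝ) × (Fin n → ℝ)) : Matrix m m ℝ :=
  gser (fun i => (Real.pi / 2) • pderivAt H i z.1) z.2

lemma pderivAt_herm {n : ℕ} {H : (Fin n → ℝ) → Matrix m m ℝ} (hH : ∀ x, (H x).IsHermitian)
    (i : Fin n) (x : Fin n → ℝ) : (pderivAt H i x).IsHermitian := by
  ext r c
  have : (fun y => H y c r) = fun y => H y r c := funext fun y => by simpa using (hH y).apply r c
  simp [pderivAt, this]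

lemma continuous_pderivAt {n : ℕ} {R C : Type*} {H : (Fin n → ℝ) → Matrix R C ℝ}
    (hs : ∀ i j, ContDiff ℝ (⊤ : ℕ∞) fun y => H y i j) (i : Fin n) :
    Continuous (pderivAt H i) := by
  refine continuous_matrix fun r c => ?_
  have h := (hs r c).continuous_fderiv (by simp)
  exact h.clm_apply continuous_const

lemma Gfld_herm {n : ℕ} {H : (Fin n → ℝ) → Matrix m m ℝ} (hH : ∀ x, (H x).IsHermitian)
    (z : (Fin n → ℝ) × (Fin n → ℝ)) : (Gfld H z).IsHermitian := by
  refine gser_herm (fun i => ?_) _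
  have := (pderivAt_herm hH i z.1).eq
  rw [IsHermitian, Matrix.conjTranspose_smul, this]; simp

lemma continuous_Gfld {n : ℕ} {H : (Fin n → ℝ) → Matrix m m ℝ}
    (hs : ∀ i j, ContDiff ℝ (⊤ : ℕ∞) fun y => H y i j) : Continuous (Gfld H) := by
  unfold Gfld gser
  have := fun i => (continuous_pderivAt hs i).comp (continuous_fst (X := Fin n → ℝ) (Y := Fin n → ℝ))
  refine continuous_finsetSum _ fun i _ => ?_
  exact ((continuous_apply i).comp continuous_snd).smul ((this i).const_smul (Real.pi / 2))

lemma Gfld_apply {n : ℕ} (H : (Fin n → ℝ) → Matrix m m ℝ)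
    (z : (Fin n → ℝ) × (Fin n → ℝ)) (r c : m) :
    Gfld H z r c = Real.pi / 2 * fderiv ℝ (fun y => H y r c) z.1 z.2 := by
  have e : z.2 = ∑ i, z.2 i • (Pi.single i (1 : ℝ) : Fin n → ℝ) := by
    ext j; simp [Finset.sum_apply, Pi.single_apply]
  conv_rhs => rw [e]
  rw [map_sum, Finset.mul_sum, Gfld, gser, Matrix.sum_apply]
  refine Finset.sum_congr rfl fun i _ => ?_
  rw [map_smul]
  simp [pderivAt]
  ring

lemma cont_rot {X : Type*} [TopologicalSpace X] {n : ℕ} {f : X → ℝ}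
    {g : X → (Fin n → ℝ) × (Fin n → ℝ)} (hf : Continuous f) (hg : Continuous g) :
    Continuous fun w => ContinuousLinearMap.rotation (E := Fin n → ℝ) (f w) (g w) := by
  have : ∀ w, ContinuousLinearMap.rotation (E := Fin n → ℝ) (f w) (g w) =
      (Real.cos (f w) • (g w).1 + Real.sin (f w) • (g w).2,
        -Real.sin (f w) • (g w).1 + Real.cos (f w) • (g w).2) :=
    fun w => rfl
  simp only [this]
  fun_prop

lemma ftc_rot {n : ℕ} {H : (Fin n → ℝ) → Matrix m m ℝ}
    (hs : ∀ i j, ContDiff ℝ (⊤ : ℕ∞) fun y => H y i j) (z : (Fin n → ℝ) × (Fin n → ℝ)) :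
    matIntegral uni (fun θ => Gfld H (ContinuousLinearMap.rotation (E := Fin n → ℝ) θ z))
      = H z.2 - H z.1 := by
  ext r c
  have hcr : Continuous fun θ : ℝ => ContinuousLinearMap.rotation (E := Fin n → ℝ) θ z := cont_rot continuous_id continuous_const
  have hc : Continuous fun θ : ℝ => fderiv ℝ (fun y => H y r c)
      (ContinuousLinearMap.rotation (E := Fin n → ℝ) θ z).1
      (ContinuousLinearMap.rotation (E := Fin n → ℝ) θ z).2 :=
    (((hs r c).continuous_fderiv (by simp)).comp (continuous_fst.comp hcr)).clm_apply
      (continuous_snd.comp hcr)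
  have hd : ∀ θ : ℝ, HasDerivAt (fun θ : ℝ => H (Real.cos θ • z.1 + Real.sin θ • z.2) r c)
      (fderiv ℝ (fun y => H y r c)
      (ContinuousLinearMap.rotation (E := Fin n → ℝ) θ z).1
      (ContinuousLinearMap.rotation (E := Fin n → ℝ) θ z).2) θ := fun θ => by
    have h1 : HasDerivAt (fun θ : ℝ => Real.cos θ • z.1 + Real.sin θ • z.2)
        (-Real.sin θ • z.1 + Real.cos θ • z.2) θ :=
      ((Real.hasDerivAt_cos θ).smul_const z.1).add ((Real.hasDerivAt_sin θ).smul_const z.2)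
    have h2 : HasFDerivAt (fun y => H y r c) (fderiv ℝ (fun y => H y r c)
        (Real.cos θ • z.1 + Real.sin θ • z.2)) (Real.cos θ • z.1 + Real.sin θ • z.2) :=
      ((hs r c).differentiable (by simp) _).hasFDerivAt
    exact h2.comp_hasDerivAt θ h1
  have hpi := Real.pi_pos
  change ∫ θ, Gfld H (ContinuousLinearMap.rotation (E := Fin n → ℝ) θ z) r c ∂uni = _
  simp only [Gfld_apply]
  rw [integral_const_mul, uni_integral,
    intervalIntegral.integral_eq_sub_of_hasDerivAt (fun θ _ => hd θ) (hc.intervalIntegrable _ _)]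
  simp only [Real.cos_pi_div_two, Real.sin_pi_div_two, Real.cos_zero, Real.sin_zero, zero_smul,
    one_smul, zero_add, add_zero, Matrix.sub_apply]
  field_simp

lemma trf_scale {A : Matrix m m ℝ} (hA : A.IsHermitian) {r p : ℝ} (hr : 0 ≤ r) :
    trf (absP p) (r • A) = r ^ p * trf (absP p) A := by
  rw [trf_comp_mul hA, trf_eq hA, trf_eq hA, Finset.mul_sum]
  refine Finset.sum_congr rfl fun i _ => ?_
  simp only [absP]
  rw [abs_mul, abs_of_nonneg hr, Real.mul_rpow hr (abs_nonneg _)]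

lemma herm_moments {n : ℕ} {H : (Fin n → ℝ) → Matrix m m ℝ} (hH : ∀ x, (H x).IsHermitian)
    (hs : ∀ i j, ContDiff ℝ (⊤ : ℕ∞) fun y => H y i j)
    (hi : ∀ i j, Integrable (fun x => H x i j) (gm n)) {t : ℝ} (ht : t = 1 ∨ 3 / 2 ≤ t) :
    ∫⁻ x, ENNReal.ofReal (trf (absP (2 * t)) (H x - matIntegral (gm n) H)) ∂(gm n) ≤
      ∫⁻ x, ENNReal.ofReal ((Real.pi ^ 2 / 4 * (2 * t - 1)) ^ t *
        trf (absP t) (∑ i, pderivAt H i x * pderivAt H i x)) ∂(gm n) := by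
  have ht1 : 1 ≤ t := by rcases ht with h | h <;> linarith
  have hU := uni_prob
  have hcH : Continuous H := continuous_matrix fun i j => (hs i j).continuous
  have h1 : ∀ y, ENNReal.ofReal (trf (absP (2 * t)) (H y - matIntegral (gm n) H)) ≤
      ∫⁻ x, ENNReal.ofReal (trf (absP (2 * t)) (H y - H x)) ∂(gm n) := fun y => by
    have e : H y - matIntegral (gm n) H = matIntegral (gm n) (fun x => H y - H x) := by
      ext r c
      simp only [matIntegral, Matrix.sub_apply, Matrix.of_apply]
      rw [integral_sub (integrable_const _) (hi r c)]
      simp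
    rw [e]
    refine jensen_trf _ (fun x => (hH y).sub (hH x)) (fun i j => ?_) (by linarith)
    exact (integrable_const _).sub (hi i j)
  have hcR : ∀ z : (Fin n → ℝ) × (Fin n → ℝ), Continuous fun θ : ℝ =>
      ContinuousLinearMap.rotation (E := Fin n → ℝ) θ z := fun z =>
    cont_rot continuous_id continuous_const
  have h2 : ∀ z : (Fin n → ℝ) × (Fin n → ℝ),
      ENNReal.ofReal (trf (absP (2 * t)) (H z.2 - H z.1)) ≤ ∫⁻ θ, ENNReal.ofReal
        (trf (absP (2 * t)) (Gfld H (ContinuousLinearMap.rotation (E := Fin n → ℝ) θ z))) ∂uni :=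
    fun z => by
      rw [← ftc_rot hs]
      refine jensen_trf _ (fun θ => Gfld_herm hH _) (fun i j => uni_integrable ?_) (by linarith)
      exact ((continuous_Gfld hs).comp (hcR z)).matrix_elem i j
  have hcT : Continuous fun z => trf (absP (2 * t)) (Gfld H z) :=
    continuous_trf (continuous_absP (by linarith)) (continuous_Gfld hs) (Gfld_herm hH)
  have hcD : Continuous fun z : (Fin n → ℝ) × (Fin n → ℝ) =>
      trf (absP (2 * t)) (H z.2 - H z.1) :=
    continuous_trf (continuous_absP (by linarith))
      ((hcH.comp continuous_snd).sub (hcH.comp continuous_fst)) (fun z => (hH _).sub (hH _))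
  calc ∫⁻ y, ENNReal.ofReal (trf (absP (2 * t)) (H y - matIntegral (gm n) H)) ∂(gm n)
      ≤ ∫⁻ y, ∫⁻ x, ENNReal.ofReal (trf (absP (2 * t)) (H y - H x)) ∂(gm n) ∂(gm n) :=
        lintegral_mono h1
    _ = ∫⁻ z : (Fin n → ℝ) × (Fin n → ℝ), ENNReal.ofReal (trf (absP (2 * t)) (H z.2 - H z.1))
          ∂((gm n).prod (gm n)) := by
        rw [lintegral_prod_symm _ hcD.measurable.ennreal_ofReal.aemeasurable]
    _ ≤ ∫⁻ z, ∫⁻ θ, ENNReal.ofReal (trf (absP (2 * t))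
          (Gfld H (ContinuousLinearMap.rotation (E := Fin n → ℝ) θ z))) ∂uni
          ∂((gm n).prod (gm n)) := lintegral_mono h2
    _ = ∫⁻ θ, ∫⁻ z, ENNReal.ofReal (trf (absP (2 * t))
          (Gfld H (ContinuousLinearMap.rotation (E := Fin n → ℝ) θ z)))
          ∂((gm n).prod (gm n)) ∂uni := by
        refine lintegral_lintegral_swap (Measurable.aemeasurable ?_)
        exact (hcT.comp (cont_rot continuous_snd continuous_fst)).measurable.ennreal_ofReal
    _ = ∫⁻ _, ∫⁻ z, ENNReal.ofReal (trf (absP (2 * t)) (Gfld H z)) ∂((gm n).prod (gm n)) ∂uni := by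
        refine lintegral_congr fun θ => ?_
        exact (gm_rot n θ).lintegral_comp hcT.measurable.ennreal_ofReal
    _ = ∫⁻ z, ENNReal.ofReal (trf (absP (2 * t)) (Gfld H z)) ∂((gm n).prod (gm n)) := by simp
    _ = ∫⁻ x, ∫⁻ y, ENNReal.ofReal (trf (absP (2 * t)) (Gfld H (x, y))) ∂(gm n) ∂(gm n) := by
        rw [lintegral_prod _ hcT.measurable.ennreal_ofReal.aemeasurable]
    _ ≤ _ := by
        refine lintegral_mono fun x => ?_
        have hD : ∀ i, ((Real.pi / 2) • pderivAt H i x).IsHermitian := fun i => by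
          have := (pderivAt_herm hH i x).eq
          rw [IsHermitian, Matrix.conjTranspose_smul, this]; simp
        have hV : (∑ i, pderivAt H i x * pderivAt H i x).IsHermitian := by
          have h : ∀ i, (pderivAt H i x)ᵀ = pderivAt H i x := fun i => by
            simpa using (pderivAt_herm hH i x).eq
          simp [IsHermitian, Matrix.transpose_sum, Matrix.transpose_mul, h]
        have hk := nck hD ht
        have e : (∑ i, (Real.pi / 2) • pderivAt H i x * (Real.pi / 2) • pderivAt H i x)
            = (Real.pi ^ 2 / 4) • ∑ i, pderivAt H i x * pderivAt H i x := by
          rw [Finset.smul_sum]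
          refine Finset.sum_congr rfl fun i _ => ?_
          rw [Matrix.smul_mul, Matrix.mul_smul, smul_smul]
          congr 1; ring
        rw [e, trf_scale hV (by positivity), ← mul_assoc, mul_comm ((2 * t - 1) ^ t),
          ← Real.mul_rpow (by positivity) (by linarith)] at hk
        change ∫⁻ y, ENNReal.ofReal (trf (absP (2 * t))
          (gser (fun i => (Real.pi / 2) • pderivAt H i x) y)) ∂(gm n) ≤ _
        rw [← ofReal_integral_eq_lintegral_ofReal (gser_integrable hD (by linarith))
          (ae_of_all _ fun y => trf_nonneg (absP_nonneg _) (gser_herm hD y))]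
        exact ENNReal.ofReal_le_ofReal hk

end HermitianMoments

section Dilation

variable {d₁ d₂ : Type*} [Fintype d₁] [Fintype d₂] [DecidableEq d₁] [DecidableEq d₂]

lemma exists_interp (f : ℝ → ℝ) {S : Set ℝ} (hS : S.Finite) :
    ∃ p : Polynomial ℝ, ∀ x ∈ S, p.eval x = f x := by
  classical
  refine ⟨Lagrange.interpolate hS.toFinset id f, fun x hx => ?_⟩
  have := Lagrange.eval_interpolate_at_node (s := hS.toFinset) (v := id) f
    (Set.injOn_id _) ((hS.mem_toFinset).mpr hx)
  simpa using this

lemma cfc_eq_aeval {m : Type*} [Fintype m] [DecidableEq m] {A : Matrix m m ℝ}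
    (hA : A.IsHermitian) {f : ℝ → ℝ} {p : Polynomial ℝ}
    (h : ∀ x ∈ spectrum ℝ A, p.eval x = f x) : cfc f A = Polynomial.aeval A p := by
  rw [← cfc_polynomial p A hA]
  exact cfc_congr fun x hx => (h x hx).symm

lemma aeval_block (P : Matrix d₁ d₁ ℝ) (Q : Matrix d₂ d₂ ℝ) (p : Polynomial ℝ) :
    Polynomial.aeval (fromBlocks P 0 0 Q) p =
      fromBlocks (Polynomial.aeval P p) 0 0 (Polynomial.aeval Q p) := by
  induction p using Polynomial.induction_on' with
  | add p q hp hq => simp [hp, hq, fromBlocks_add]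
  | monomial k a =>
    simp only [Polynomial.aeval_monomial, ← Algebra.smul_def]
    rw [Matrix.fromBlocks_diagonal_pow, fromBlocks_smul]
    simp

lemma block_herm {P : Matrix d₁ d₁ ℝ} {Q : Matrix d₂ d₂ ℝ} (hP : P.IsHermitian)
    (hQ : Q.IsHermitian) : (fromBlocks P 0 0 Q).IsHermitian :=
  hP.fromBlocks (by simp) hQ

lemma trf_block {P : Matrix d₁ d₁ ℝ} {Q : Matrix d₂ d₂ ℝ} (hP : P.IsHermitian)
    (hQ : Q.IsHermitian) (f : ℝ → ℝ) : trf f (fromBlocks P 0 0 Q) = trf f P + trf f Q := by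
  obtain ⟨p, hp⟩ := exists_interp f (((Matrix.finite_real_spectrum (A := P)).union
    (Matrix.finite_real_spectrum (A := Q))).union
    (Matrix.finite_real_spectrum (A := fromBlocks P 0 0 Q)))
  unfold trf
  rw [cfc_eq_aeval hP fun x hx => hp x (Or.inl (Or.inl hx)),
    cfc_eq_aeval hQ fun x hx => hp x (Or.inl (Or.inr hx)),
    cfc_eq_aeval (block_herm hP hQ) fun x hx => hp x (Or.inr hx), aeval_block]
  simp [Matrix.trace, Fintype.sum_sum_type]

lemma trace_pow_comm (A : Matrix d₁ d₂ ℝ) (k : ℕ) :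
    ((A * Aᵀ) ^ (k + 1)).trace = ((Aᵀ * A) ^ (k + 1)).trace := by
  have h : ∀ k : ℕ, (A * Aᵀ) ^ (k + 1) = A * (Aᵀ * A) ^ k * Aᵀ := fun k => by
    induction k with
    | zero => simp
    | succ k ih => rw [pow_succ, ih, pow_succ]; simp only [Matrix.mul_assoc]
  rw [h, Matrix.mul_assoc, Matrix.trace_mul_comm, Matrix.mul_assoc, pow_succ]

lemma trf_comm (A : Matrix d₁ d₂ ℝ) {f : ℝ → ℝ} (hf : f 0 = 0) :
    trf f (A * Aᵀ) = trf f (Aᵀ * A) := by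
  have hP : (A * Aᵀ).IsHermitian := by simpa using isHermitian_mul_conjTranspose_self A
  have hQ : (Aᵀ * A).IsHermitian := by simpa using isHermitian_conjTranspose_mul_self A
  obtain ⟨p, hp⟩ := exists_interp f (((Matrix.finite_real_spectrum (A := A * Aᵀ)).union
    (Matrix.finite_real_spectrum (A := Aᵀ * A))).union (Set.finite_singleton 0))
  have h0 : p.coeff 0 = 0 := by
    rw [Polynomial.coeff_zero_eq_eval_zero, hp 0 (Or.inr rfl), hf]
  unfold trf
  rw [cfc_eq_aeval hP fun x hx => hp x (Or.inl (Or.inl hx)),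
    cfc_eq_aeval hQ fun x hx => hp x (Or.inl (Or.inr hx)),
    Polynomial.aeval_eq_sum_range, Polynomial.aeval_eq_sum_range, Matrix.trace_sum,
    Matrix.trace_sum]
  refine Finset.sum_congr rfl fun k _ => ?_
  rcases k with _ | k
  · simp [h0]
  · rw [Matrix.trace_smul, Matrix.trace_smul, trace_pow_comm]

/-- Hermitian dilation -/
def dil (A : Matrix d₁ d₂ ℝ) : Matrix (d₁ ⊕ d₂) (d₁ ⊕ d₂) ℝ := fromBlocks 0 A Aᵀ 0

lemma dil_herm (A : Matrix d₁ d₂ ℝ) : (dil A).IsHermitian := by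
  refine IsHermitian.fromBlocks (by simp) (by simp) (by simp)

lemma dil_sq (A : Matrix d₁ d₂ ℝ) : dil A * dil A = fromBlocks (A * Aᵀ) 0 0 (Aᵀ * A) := by
  simp [dil, fromBlocks_multiply]

lemma schattenPow_eq {R C : Type*} [Fintype R] [Fintype C] [DecidableEq C]
    (t : ℝ) (A : Matrix R C ℝ) : schattenPow t A = trf (absP t) (Aᵀ * A) := by
  have e : Aᵀ * A = Aᴴ * A := by simp
  rw [e, trf_eq (isHermitian_conjTranspose_mul_self A), schattenPow]
  refine Finset.sum_congr rfl fun i _ => ?_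
  rw [absP, abs_of_nonneg ((posSemidef_conjTranspose_mul_self A).eigenvalues_nonneg i)]

lemma trf_dil {t : ℝ} (ht : 1 ≤ t) (A : Matrix d₁ d₂ ℝ) :
    trf (absP (2 * t)) (dil A) = 2 * schattenPow t A := by
  have hP : (A * Aᵀ).IsHermitian := by simpa using isHermitian_mul_conjTranspose_self A
  have hQ : (Aᵀ * A).IsHermitian := by simpa using isHermitian_conjTranspose_mul_self A
  have e : trf (absP (2 * t)) (dil A) = trf (absP t) (dil A * dil A) := by
    unfold trf
    have h := cfc_comp (p := IsSelfAdjoint) (absP t) (fun x : ℝ => x * x) (dil A) (dil_herm A)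
      (((Matrix.finite_real_spectrum (A := dil A)).image _).continuousOn _) (by fun_prop)
    rw [cfc_mul_mat, cfc_id_mat (dil_herm A)] at h
    rw [← h]
    congr 2
    funext x
    simp only [absP, Function.comp_apply, ← sq]
    rw [Real.rpow_mul (abs_nonneg x), abs_pow]
    norm_num
  rw [e, dil_sq, trf_block hP hQ, trf_comm A (by rw [absP, abs_zero, Real.zero_rpow (by linarith)]), ← schattenPow_eq]
  ring

lemma sqrt_mul {m : Type*} [Fintype m] [DecidableEq m] {P : Matrix m m ℝ} (hP : P.PosSemidef) :
    (psdSqrt P)ᵀ * psdSqrt P = P := by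
  have e : psdSqrt P = hP.sqrt := by simp [psdSqrt, hP]
  rw [e, Matrix.PosSemidef.sqrt]
  have h1 : (star hP.1.eigenvectorUnitary : Matrix m m ℝ) * hP.1.eigenvectorUnitary.1 = 1 :=
    Unitary.coe_star_mul_self _
  have hs := hP.1.spectral_theorem
  set U := hP.1.eigenvectorUnitary
  have hstar : (star U : Matrix m m ℝ) = U.1ᵀ := by simp [star_eq_conjTranspose]
  have hD : diagonal (Real.sqrt ∘ hP.1.eigenvalues) * diagonal (Real.sqrt ∘ hP.1.eigenvalues)
      = diagonal hP.1.eigenvalues := by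
    rw [diagonal_mul_diagonal]
    congr 1
    funext i
    exact Real.mul_self_sqrt (hP.eigenvalues_nonneg i)
  have hs' : U.1 * diagonal hP.1.eigenvalues * U.1ᵀ = P := by
    rw [Unitary.conjStarAlgAut_apply, hstar] at hs
    exact hs.symm
  rw [hstar] at h1 ⊢
  rw [transpose_mul, transpose_mul, transpose_transpose, diagonal_transpose]
  generalize diagonal (Real.sqrt ∘ hP.1.eigenvalues) = D at hD
  calc U.1 * (D * U.1ᵀ) * (U.1 * D * U.1ᵀ) = U.1 * (D * (U.1ᵀ * U.1) * D) * U.1ᵀ := by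
        simp only [Matrix.mul_assoc]
    _ = P := by rw [h1, Matrix.mul_one, hD, hs']

lemma schatten_sqrt {m : Type*} [Fintype m] [DecidableEq m] {P : Matrix m m ℝ}
    (hP : P.PosSemidef) (t : ℝ) : schattenPow t (psdSqrt P) = trf (absP t) P := by
  rw [schattenPow_eq, sqrt_mul hP]

lemma dil_sub (A B : Matrix d₁ d₂ ℝ) : dil A - dil B = dil (A - B) := by
  simp [dil, sub_eq_add_neg, fromBlocks_neg, fromBlocks_add]

lemma matIntegral_dil {Ω : Type*} [MeasurableSpace Ω] (ν : Measure Ω) (F : Ω → Matrix d₁ d₂ ℝ) :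
    matIntegral ν (fun ω => dil (F ω)) = dil (matIntegral ν F) := by
  ext i j
  rcases i with i | i <;> rcases j with j | j <;> simp [matIntegral, dil]

lemma pderivAt_dil {n : ℕ} (F : (Fin n → ℝ) → Matrix d₁ d₂ ℝ) (k : Fin n) (x : Fin n → ℝ) :
    pderivAt (fun y => dil (F y)) k x = dil (pderivAt F k x) := by
  ext i j
  rcases i with i | i <;> rcases j with j | j <;> simp [pderivAt, dil]

end Dilation

/-- **Non-Hermitian polynomial moments** (Lemma 6.2, from Huang–Tropp). Let
`F : ℝⁿ → ℝ^{d₁ × d₂}` be a smooth matrix-valued function of a standard Gaussian vector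
`x ∼ N(0, Iₙ)` (with the stated integrability). For `t = 1` and for `t ≥ 3/2`,
`E ‖F(x) − E F(x)‖_{2t}^{2t} ≤ (√2 t)^{2t} (E ‖(∑ᵢ ∂ᵢF(x) ∂ᵢF(x)ᵀ)^{1/2}‖_{2t}^{2t}
  + E ‖(∑ᵢ ∂ᵢF(x)ᵀ ∂ᵢF(x))^{1/2}‖_{2t}^{2t})`. -/
theorem nonhermitian_polynomial_moments
    (n : ℕ) {d₁ d₂ : Type*} [Fintype d₁] [Fintype d₂] [DecidableEq d₁] [DecidableEq d₂]
    (μ : Measure (Fin n → ℝ))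
    (hμ : μ = Measure.pi fun _ => gaussianReal 0 1)
    (F : (Fin n → ℝ) → Matrix d₁ d₂ ℝ)
    (hsmooth : ∀ i j, ContDiff ℝ (⊤ : ℕ∞) fun y => F y i j)
    (hint : ∀ i j, Integrable (fun x => F x i j) μ)
    (t : ℝ) (ht : t = 1 ∨ 3 / 2 ≤ t)
    (hint₁ : Integrable (fun x =>
      schattenPow t (psdSqrt (∑ i, pderivAt F i x * (pderivAt F i x)ᵀ))) μ)
    (hint₂ : Integrable (fun x =>
      schattenPow t (psdSqrt (∑ i, (pderivAt F i x)ᵀ * pderivAt F i x))) μ) :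
    ∫ x, schattenPow t (F x - matIntegral μ F) ∂μ
      ≤ (Real.sqrt 2 * t) ^ (2 * t) *
          ((∫ x, schattenPow t (psdSqrt (∑ i, pderivAt F i x * (pderivAt F i x)ᵀ)) ∂μ)
            + ∫ x, schattenPow t (psdSqrt (∑ i, (pderivAt F i x)ᵀ * pderivAt F i x)) ∂μ) := by
  subst hμ
  change ∫ x, schattenPow t (F x - matIntegral (gm n) F) ∂(gm n) ≤ (Real.sqrt 2 * t) ^ (2 * t) *
      ((∫ x, schattenPow t (psdSqrt (∑ i, pderivAt F i x * (pderivAt F i x)ᵀ)) ∂(gm n))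
        + ∫ x, schattenPow t (psdSqrt (∑ i, (pderivAt F i x)ᵀ * pderivAt F i x)) ∂(gm n))
  have ht1 : 1 ≤ t := by rcases ht with h | h <;> linarith
  have hP : ∀ x, (∑ i, pderivAt F i x * (pderivAt F i x)ᵀ).PosSemidef := fun x =>
    posSemidef_sum _ fun i _ => by simpa using posSemidef_self_mul_conjTranspose (pderivAt F i x)
  have hQ : ∀ x, (∑ i, (pderivAt F i x)ᵀ * pderivAt F i x).PosSemidef := fun x =>
    posSemidef_sum _ fun i _ => by simpa using posSemidef_conjTranspose_mul_self (pderivAt F i x)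
  have hsp : ∀ A : Matrix d₁ d₂ ℝ, 0 ≤ schattenPow t A := fun A =>
    Finset.sum_nonneg fun i _ =>
      Real.rpow_nonneg ((posSemidef_conjTranspose_mul_self A).eigenvalues_nonneg i) _
  have hP0 : ∀ x, 0 ≤ schattenPow t (psdSqrt (∑ i, pderivAt F i x * (pderivAt F i x)ᵀ)) :=
    fun x => by rw [schatten_sqrt (hP x)]; exact trf_nonneg (absP_nonneg _) (hP x).1
  have hQ0 : ∀ x, 0 ≤ schattenPow t (psdSqrt (∑ i, (pderivAt F i x)ᵀ * pderivAt F i x)) :=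
    fun x => by rw [schatten_sqrt (hQ x)]; exact trf_nonneg (absP_nonneg _) (hQ x).1
  have main := herm_moments (n := n) (H := fun y => dil (F y)) (fun x => dil_herm _)
    (fun i j => by
      rcases i with i | i <;> rcases j with j | j
      · simpa [dil] using contDiff_const
      · simpa [dil] using hsmooth i j
      · simpa [dil] using hsmooth j i
      · simpa [dil] using contDiff_const)
    (fun i j => by
      rcases i with i | i <;> rcases j with j | j
      · simp [dil]
      · simpa [dil] using hint i j
      · simpa [dil] using hint j i
      · simp [dil]) ht
  have eL : ∀ x, trf (absP (2 * t)) (dil (F x) - matIntegral (gm n) (fun y => dil (F y)))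
      = 2 * schattenPow t (F x - matIntegral (gm n) F) := fun x => by
    rw [matIntegral_dil, dil_sub, trf_dil ht1]
  have eR : ∀ x, trf (absP t) (∑ i, pderivAt (fun y => dil (F y)) i x *
        pderivAt (fun y => dil (F y)) i x)
      = schattenPow t (psdSqrt (∑ i, pderivAt F i x * (pderivAt F i x)ᵀ))
        + schattenPow t (psdSqrt (∑ i, (pderivAt F i x)ᵀ * pderivAt F i x)) := fun x => by
    have e : ∑ i, pderivAt (fun y => dil (F y)) i x * pderivAt (fun y => dil (F y)) i x
        = fromBlocks (∑ i, pderivAt F i x * (pderivAt F i x)ᵀ) 0 0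
          (∑ i, (pderivAt F i x)ᵀ * pderivAt F i x) := by
      simp only [pderivAt_dil, dil_sq]
      ext i j
      rcases i with i | i <;> rcases j with j | j <;> simp [Matrix.sum_apply]
    rw [e, trf_block (hP x).1 (hQ x).1, schatten_sqrt (hP x), schatten_sqrt (hQ x)]
  simp only [eL, eR] at main
  set IP := ∫ x, schattenPow t (psdSqrt (∑ i, pderivAt F i x * (pderivAt F i x)ᵀ)) ∂(gm n)
  set IQ := ∫ x, schattenPow t (psdSqrt (∑ i, (pderivAt F i x)ᵀ * pderivAt F i x)) ∂(gm n)
  have hIP : 0 ≤ IP := integral_nonneg hP0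
  have hIQ : 0 ≤ IQ := integral_nonneg hQ0
  have hc0 : 0 ≤ (Real.pi ^ 2 / 4 * (2 * t - 1)) ^ t :=
    Real.rpow_nonneg (mul_nonneg (by positivity) (by linarith)) _
  have hi12 := (hint₁.add hint₂).const_mul ((Real.pi ^ 2 / 4 * (2 * t - 1)) ^ t)
  have hR := ofReal_integral_eq_lintegral_ofReal hi12
    (ae_of_all _ fun x => mul_nonneg hc0 (add_nonneg (hP0 x) (hQ0 x)))
  rw [integral_const_mul, integral_add' hint₁ hint₂] at hR
  have hc := const_ineq ht1
  by_cases hL : Integrable (fun x => schattenPow t (F x - matIntegral (gm n) F)) (gm n)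
  · have hLi := ofReal_integral_eq_lintegral_ofReal (hL.const_mul 2)
      (ae_of_all _ fun x => mul_nonneg zero_le_two (hsp _))
    rw [integral_const_mul] at hLi
    have h2 : ENNReal.ofReal (2 * ∫ x, schattenPow t (F x - matIntegral (gm n) F) ∂(gm n)) ≤
        ENNReal.ofReal ((Real.pi ^ 2 / 4 * (2 * t - 1)) ^ t * (IP + IQ)) := by
      rw [hLi]; exact main.trans (le_of_eq hR.symm)
    have h3 := (ENNReal.ofReal_le_ofReal_iff (mul_nonneg hc0 (add_nonneg hIP hIQ))).mp h2
    have h4 := mul_le_mul_of_nonneg_right hc (add_nonneg hIP hIQ)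
    linarith
  · rw [integral_undef hL]
    exact mul_nonneg (Real.rpow_nonneg (by positivity) _) (add_nonneg hIP hIQ)
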